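/- arXiv:2110.09261 — 2 statements merged into one kernel-verified Lean document; each statement's English description precedes it below -/
import Mathlib

section
/- Let φ: Ω → Ω̃ be a weak (n,q)-quasiconformal mapping between domains in ℝⁿ, 1 ≤ q < n. Then there exists a constant C such that the volume derivative of the inverse mapping satisfies J_{φ⁻¹}(y₀) ≤ C (H_q(y₀))^{nq/(n−q)} for almost all y₀ ∈ Ω̃. -/
open MeasureTheory ENNReal Set Filter
open scoped RealInnerProductSpace

noncomputable section

attribute [local instance] Classical.propDecidable

/-- Euclidean space `ℝⁿ`. -/
abbrev Euc (n : ℕ) := EuclideanSpace ℝ (Fin n)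

/-- A (parametrized) curve in `ℝⁿ`: a function considered on a compact interval `[a,b]`. -/
structure Curve (n : ℕ) where
  a : ℝ
  b : ℝ
  hab : a ≤ b
  toFun : ℝ → Euc n

namespace Curve

variable {n : ℕ}

/-- The curve lies in the set `Ω`. -/
def In (γ : Curve n) (Ω : Set (Euc n)) : Prop :=
  ∀ t ∈ Icc γ.a γ.b, γ.toFun t ∈ Ω

/-- The curve is a (continuous) path. -/
def IsPath (γ : Curve n) : Prop := ContinuousOn γ.toFun (Icc γ.a γ.b)

/-- The curve is rectifiable: it has finite length (total variation). -/
def Rectifiable (γ : Curve n) : Prop := eVariationOn γ.toFun (Icc γ.a γ.b) < ⊤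

/-- `c : [0,l] → ℝⁿ` is a unit-speed (arclength) reparametrization of the curve `γ`. -/
def IsArclengthParam (γ : Curve n) (l : ℝ) (c : ℝ → Euc n) : Prop :=
  0 ≤ l ∧ (∀ t ∈ Icc (0:ℝ) l, eVariationOn c (Icc 0 t) = ENNReal.ofReal t) ∧
  ∃ σ : ℝ → ℝ, MonotoneOn σ (Icc γ.a γ.b) ∧ σ γ.a = 0 ∧ σ γ.b = l ∧
    (∀ t ∈ Icc γ.a γ.b, σ t ∈ Icc 0 l) ∧ ∀ t ∈ Icc γ.a γ.b, γ.toFun t = c (σ t)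

/-- The line integral `∫_γ ρ ds`, computed through an arclength parametrization of `γ`
(equal to `∞` if no arclength parametrization exists, e.g. for non-rectifiable curves). -/
def lineIntegral (γ : Curve n) (ρ : Euc n → ℝ≥0∞) : ℝ≥0∞ :=
  ⨅ (l : ℝ) (c : ℝ → Euc n) (_ : γ.IsArclengthParam l c),
    ∫⁻ t in Icc (0:ℝ) l, ρ (c t)

/-- The image curve `φ ∘ γ`. -/
def map (γ : Curve n) (φ : Euc n → Euc n) : Curve n :=
  ⟨γ.a, γ.b, γ.hab, φ ∘ γ.toFun⟩

end Curve

/-- `ρ` is an admissible (non-negative Borel) function for the curve family `Γ`: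
`∫_γ ρ ds ≥ 1` for every (locally) rectifiable `γ ∈ Γ`. -/
def IsAdmissible {n : ℕ} (Γ : Set (Curve n)) (ρ : Euc n → ℝ≥0∞) : Prop :=
  Measurable ρ ∧ ∀ γ ∈ Γ, γ.Rectifiable → 1 ≤ γ.lineIntegral ρ

/-- The conformal modulus `M(Γ)` of a family of curves in `ℝⁿ`. -/
def modulus {n : ℕ} (Γ : Set (Curve n)) : ℝ≥0∞ :=
  ⨅ (ρ : Euc n → ℝ≥0∞) (_ : IsAdmissible Γ ρ), ∫⁻ x, ρ x ^ (n : ℝ)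

/-- `φ` is a homeomorphism of `Ω` onto `Ω'`. -/
def IsHomeoOn {n : ℕ} (φ : Euc n → Euc n) (Ω Ω' : Set (Euc n)) : Prop :=
  Set.BijOn φ Ω Ω' ∧ ContinuousOn φ Ω ∧ ContinuousOn (Function.invFunOn φ Ω) Ω'

/-- `φ : Ω → Ω'` is a `Q`-homeomorphism: `M(φΓ) ≤ ∫_Ω Q ρⁿ` for every family `Γ` of
rectifiable paths in `Ω` and every admissible function `ρ` for `Γ`. -/
def IsQHomeo {n : ℕ} (φ : Euc n → Euc n) (Ω Ω' : Set (Euc n)) (Q : Euc n → ℝ≥0∞) : Prop :=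
  IsHomeoOn φ Ω Ω' ∧ Measurable Q ∧
  ∀ Γ : Set (Curve n), (∀ γ ∈ Γ, γ.In Ω ∧ γ.IsPath ∧ γ.Rectifiable) →
    ∀ ρ : Euc n → ℝ≥0∞, IsAdmissible Γ ρ →
      modulus ((fun γ => γ.map φ) '' Γ) ≤ ∫⁻ x in Ω, Q x * ρ x ^ (n : ℝ)

/-- `g` is a weak gradient of the scalar function `f` on `Ω` (integration by parts against
smooth compactly supported test functions). -/
def HasWeakGradientOn {n : ℕ} (f : Euc n → ℝ) (g : Euc n → Euc n) (Ω : Set (Euc n)) : Prop :=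
  LocallyIntegrableOn f Ω ∧ LocallyIntegrableOn g Ω ∧
  ∀ η : Euc n → ℝ, ContDiff ℝ (⊤ : ℕ∞) η → HasCompactSupport η → tsupport η ⊆ Ω →
    ∀ v : Euc n, ∫ x in Ω, f x * fderiv ℝ η x v = - ∫ x in Ω, ⟪g x, v⟫ * η x

/-- `D` is a weak differential of the mapping `φ : Ω → ℝⁿ`. -/
def HasWeakDerivOn {n : ℕ} (φ : Euc n → Euc n) (D : Euc n → Euc n →L[ℝ] Euc n)
    (Ω : Set (Euc n)) : Prop :=
  LocallyIntegrableOn φ Ω ∧ LocallyIntegrableOn D Ω ∧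
  ∀ η : Euc n → ℝ, ContDiff ℝ (⊤ : ℕ∞) η → HasCompactSupport η → tsupport η ⊆ Ω →
    ∀ v : Euc n, ∫ x in Ω, fderiv ℝ η x v • φ x = - ∫ x in Ω, η x • D x v

/-- The Jacobian `J(x,φ) = det Dφ(x)`. -/
def jacobian {n : ℕ} (D : Euc n → Euc n →L[ℝ] Euc n) (x : Euc n) : ℝ :=
  LinearMap.det (D x : Euc n →ₗ[ℝ] Euc n)

/-- `φ` (with weak differential `D`) has finite distortion on `Ω`:
`Dφ(x) = 0` a.e. on the zero set of the Jacobian. -/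
def FiniteDistortionOn {n : ℕ} (D : Euc n → Euc n →L[ℝ] Euc n) (Ω : Set (Euc n)) : Prop :=
  ∀ᵐ x ∂(volume.restrict Ω), jacobian D x = 0 → D x = 0

/-- The `L_p`-norm (`p ∈ (0,∞]`) of an `ℝ≥0∞`-valued function. -/
def lpNormE {n : ℕ} (f : Euc n → ℝ≥0∞) (p : ℝ≥0∞) (μ : Measure (Euc n)) : ℝ≥0∞ :=
  if p = ∞ then essSup f μ else (∫⁻ x, f x ^ p.toReal ∂μ) ^ (1 / p.toReal)

/-- `ψ : Ω → Ω'` generates, by the composition rule `f ↦ f ∘ ψ`, a bounded composition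
operator `L¹_p(Ω') → L¹_q(Ω)` with constant `K`. -/
def IsCompOpBddWith {n : ℕ} (Ω Ω' : Set (Euc n)) (ψ : Euc n → Euc n) (p q K : ℝ≥0∞) : Prop :=
  ∀ (f : Euc n → ℝ) (gf : Euc n → Euc n), HasWeakGradientOn f gf Ω' →
    lpNormE (fun x => (‖gf x‖₊ : ℝ≥0∞)) p (volume.restrict Ω') ≠ ∞ →
    ∃ g : Euc n → Euc n, HasWeakGradientOn (f ∘ ψ) g Ω ∧
      lpNormE (fun x => (‖g x‖₊ : ℝ≥0∞)) q (volume.restrict Ω) ≤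
        K * lpNormE (fun x => (‖gf x‖₊ : ℝ≥0∞)) p (volume.restrict Ω')

/-- `ψ : Ω → Ω'` generates a bounded composition operator `L¹_p(Ω') → L¹_q(Ω)`. -/
def IsCompOpBdd {n : ℕ} (Ω Ω' : Set (Euc n)) (ψ : Euc n → Euc n) (p q : ℝ≥0∞) : Prop :=
  ∃ K : ℝ≥0∞, K ≠ ∞ ∧ IsCompOpBddWith Ω Ω' ψ p q K

/-- The volume derivative `J_{φ⁻¹}(y) = lim_{r→0} |φ⁻¹(B(y,r))| / |B(y,r)|`
(as a limsup, so that it is everywhere defined). -/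
def volDerivInv {n : ℕ} (φ : Euc n → Euc n) (Ω : Set (Euc n)) (y : Euc n) : ℝ≥0∞ :=
  limsup (fun r : ℝ => volume (Ω ∩ φ ⁻¹' Metric.ball y r) / volume (Metric.ball y r))
    (nhdsWithin 0 (Ioi 0))

/-- The distortion function `H_q(y) = (|Dφ(x)|^q/|J(x,φ)|)^{1/q}` at `x = φ⁻¹(y)` outside
the singular set `S` and the zero set of the Jacobian, and `0` otherwise. -/
def distortionH {n : ℕ} (D : Euc n → Euc n →L[ℝ] Euc n) (φ : Euc n → Euc n)
    (Ω S : Set (Euc n)) (q : ℝ) (y : Euc n) : ℝ≥0∞ :=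
  if Function.invFunOn φ Ω y ∈ Ω \ (S ∪ {x | jacobian D x = 0}) then
    ((‖D (Function.invFunOn φ Ω y)‖₊ : ℝ≥0∞) ^ q /
      ENNReal.ofReal |jacobian D (Function.invFunOn φ Ω y)|) ^ (1 / q)
  else 0

/-- The `p`-dilatation `K_p(x) = inf {k : |Dφ(x)| ≤ k |J(x,φ)|^{1/p}}`. -/
def dilK {n : ℕ} (p : ℝ≥0∞) (D : Euc n → Euc n →L[ℝ] Euc n) (x : Euc n) : ℝ≥0∞ :=
  (‖D x‖₊ : ℝ≥0∞) / (ENNReal.ofReal |jacobian D x|) ^ (1/p).toReal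

/-- Local `L_q`-integrability of the weak differential on `Ω`
(the differential part of `φ ∈ W¹_{q,loc}(Ω)`). -/
def MemWlocOn {n : ℕ} (D : Euc n → Euc n →L[ℝ] Euc n) (q : ℝ≥0∞) (Ω : Set (Euc n)) : Prop :=
  ∀ K : Set (Euc n), K ⊆ Ω → IsCompact K →
    lpNormE (fun x => (‖D x‖₊ : ℝ≥0∞)) q (volume.restrict K) ≠ ∞

/-- Minimal stretch `l(T) = min {|T h| : |h| = 1}`. -/
def minStretch {n : ℕ} (T : Euc n →L[ℝ] Euc n) : ℝ :=
  ⨅ h : {h : Euc n // ‖h‖ = 1}, ‖T h.1‖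

/-- The inner conformal dilatation `K^I(x,φ) = |J(x,φ)| / l(Dφ(x))ⁿ` (and `0` when
`J(x,φ) = 0`). -/
def innerDil {n : ℕ} (D : Euc n → Euc n →L[ℝ] Euc n) (x : Euc n) : ℝ≥0∞ :=
  if jacobian D x = 0 then 0
  else ENNReal.ofReal (|jacobian D x| / minStretch (D x) ^ n)

/-- `Ω` is an `(s,q)`-Sobolev–Poincaré domain with constant `B`. -/
def IsSobolevPoincare {n : ℕ} (Ω : Set (Euc n)) (s q : ℝ) (B : ℝ≥0∞) : Prop :=
  ∀ (g : Euc n → ℝ) (gg : Euc n → Euc n), HasWeakGradientOn g gg Ω →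
    ⨅ c : ℝ, (∫⁻ x in Ω, (‖g x - c‖₊ : ℝ≥0∞) ^ s) ^ (1/s) ≤
      B * (∫⁻ x in Ω, (‖gg x‖₊ : ℝ≥0∞) ^ q) ^ (1/q)

/-- `Ω` is a domain: an open connected set. -/
def IsDomainIn {n : ℕ} (Ω : Set (Euc n)) : Prop := IsOpen Ω ∧ IsConnected Ω

/-- The mapping satisfies the Luzin `N`-property on `Ω`. -/
def LuzinN {n : ℕ} (φ : Euc n → Euc n) (Ω : Set (Euc n)) : Prop :=
  ∀ A ⊆ Ω, volume A = 0 → volume (φ '' A) = 0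

open scoped Convolution

/-- The mollification of `F` by the normalised bump function `b`. -/
abbrev mollify {n : ℕ} (b : ContDiffBump (0 : Euc n)) (F : Euc n → Euc n) : Euc n → Euc n :=
  b.normed volume ⋆[ContinuousLinearMap.lsmul ℝ ℝ, volume] F

lemma mollify_apply {n : ℕ} (b : ContDiffBump (0 : Euc n)) (F : Euc n → Euc n) (x : Euc n) :
    mollify b F x = ∫ t, b.normed volume t • F (x - t) := rfl

lemma HasWeakDerivOn.hasFDerivAt_mollify {n : ℕ} {F : Euc n → Euc n}
    {G : Euc n → Euc n →L[ℝ] Euc n} (h : HasWeakDerivOn F G univ)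
    (b : ContDiffBump (0 : Euc n)) (x : Euc n) :
    HasFDerivAt (mollify b F) (∫ z, b.normed volume (x - z) • G z) x := by
  obtain ⟨hF, hG, h⟩ := h
  rw [locallyIntegrableOn_univ] at hF hG
  have hcs := b.hasCompactSupport_normed (μ := volume)
  have hsm : ContDiff ℝ (⊤ : ℕ∞) (b.normed volume) := b.contDiff_normed
  have key := hcs.hasFDerivAt_convolution_left (ContinuousLinearMap.lsmul ℝ ℝ)
    (b.contDiff_normed (n := 1)) hF x
  suffices e : (∫ z, b.normed volume (x - z) • G z) =
      (fderiv ℝ (b.normed volume) ⋆[ContinuousLinearMap.precompL (Euc n)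
        (ContinuousLinearMap.lsmul ℝ ℝ), volume] F) x by rw [e]; exact key
  set η : Euc n → ℝ := fun z => b.normed volume (x - z) with hη
  have hηs : ContDiff ℝ (⊤ : ℕ∞) η := hsm.comp (contDiff_const.sub contDiff_id)
  have hηc : HasCompactSupport η := hcs.comp_homeomorph (Homeomorph.subLeft x)
  have hηd : ∀ z v, fderiv ℝ η z v = - fderiv ℝ (b.normed volume) (x - z) v := by
    intro z v
    have h1 : HasFDerivAt (fun z : Euc n => x - z) (-ContinuousLinearMap.id ℝ (Euc n)) z := by
      simpa using (hasFDerivAt_id z).const_sub x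
    have h2 := ((hsm.differentiable (by simp)) (x - z)).hasFDerivAt.comp z h1
    rw [show η = b.normed volume ∘ fun z => x - z from rfl, h2.fderiv]
    simp
  ext1 v
  have hηG : Integrable (fun z => b.normed volume (x - z) • G z) :=
    hG.integrable_smul_left_of_hasCompactSupport hηs.continuous hηc
  rw [ContinuousLinearMap.integral_apply hηG]
  have e1 := h η hηs hηc (subset_univ _) v
  rw [Measure.restrict_univ] at e1
  have e2 : ∫ z, (b.normed volume (x - z) • G z) v = - ∫ z, fderiv ℝ η z v • F z := by
    rw [e1, neg_neg]; rfl
  rw [e2, ← integral_neg, convolution_def]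
  have hce : ConvolutionExistsAt (fderiv ℝ (b.normed volume)) F x
      (ContinuousLinearMap.precompL (Euc n) (ContinuousLinearMap.lsmul ℝ ℝ)) volume :=
    (hcs.fderiv ℝ).convolutionExists_left _ (hsm.continuous_fderiv (by simp)) hF x
  rw [ContinuousLinearMap.integral_apply hce, ← integral_sub_left_eq_self _ _ x]
  refine integral_congr_ae (Eventually.of_forall fun z => ?_)
  simp [hηd]

lemma norm_integral_normed_smul_le {n : ℕ} {E : Type*} [NormedAddCommGroup E] [NormedSpace ℝ E]
    {W : Euc n → E} (hW : LocallyIntegrable W)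
    (b : ContDiffBump (0 : Euc n)) {w x : Euc n} {R : ℝ} (hR : dist w x + b.rOut ≤ R) :
    ‖∫ z, b.normed volume (w - z) • W z‖ ≤
      (volume.real (Metric.closedBall (0 : Euc n) b.rIn))⁻¹ *
        ∫ z in Metric.closedBall x R, ‖W z‖ := by
  have hI : IntegrableOn (fun z => ‖W z‖) (Metric.closedBall x R) :=
    (hW.integrableOn_isCompact (isCompact_closedBall x R)).norm
  rw [← integral_const_mul, ← integral_indicator measurableSet_closedBall]
  refine norm_integral_le_of_norm_le
    ((integrable_indicator_iff measurableSet_closedBall).2 (Integrable.const_mul hI _))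
    (Eventually.of_forall fun z => ?_)
  by_cases hz : z ∈ Metric.closedBall x R
  · rw [indicator_of_mem hz, norm_smul, Real.norm_of_nonneg (b.nonneg_normed _)]
    gcongr
    simpa using b.normed_le_div_measure_closedBall_rIn volume (w - z)
  · rw [indicator_of_notMem hz]
    have : b.normed volume (w - z) = 0 := by
      rw [← Function.notMem_support, b.support_normed_eq, mem_ball_zero_iff, not_lt]
      rw [Metric.mem_closedBall, not_le] at hz
      have := dist_triangle z w x
      rw [← dist_eq_norm, dist_comm w z]
      linarith
    simp [this]

lemma mollify_comm {n : ℕ} (b c : ContDiffBump (0 : Euc n)) {F : Euc n → Euc n}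
    (hF : Continuous F) (x : Euc n) :
    mollify b (mollify c F) x = mollify c (mollify b F) x := by
  simp only [mollify_apply, ← integral_smul]
  rw [integral_integral_swap_of_hasCompactSupport]
  · refine integral_congr_ae (Eventually.of_forall fun s => integral_congr_ae
      (Eventually.of_forall fun t => ?_))
    simp only [smul_smul, mul_comm, sub_right_comm]
  · have := b.continuous_normed (μ := volume)
    have := c.continuous_normed (μ := volume)
    simp only [Function.uncurry_def]
    fun_prop
  · refine HasCompactSupport.intro
      ((b.hasCompactSupport_normed (μ := volume)).isCompact.prod
        (c.hasCompactSupport_normed (μ := volume)).isCompact) fun p hp => ?_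
    simp only [mem_prod, not_and_or] at hp
    simp only [Function.uncurry_def]
    rcases hp with hp | hp <;> simp [image_eq_zero_of_notMem_tsupport hp]

lemma mollify_clm {n : ℕ} (b : ContDiffBump (0 : Euc n)) (L : Euc n →L[ℝ] Euc n) (x : Euc n) :
    mollify b L x = L x := by
  have hi : Integrable fun t : Euc n => b.normed volume t • t :=
    (continuous_id.locallyIntegrable).integrable_smul_left_of_hasCompactSupport
      b.continuous_normed b.hasCompactSupport_normed
  have h0 : ∫ t, b.normed volume t • t = 0 := by
    have := integral_neg_eq_self (fun t : Euc n => b.normed volume t • t) volume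
    simp only [b.normed_neg, smul_neg, integral_neg] at this
    rw [neg_eq_iff_add_eq_zero, ← two_smul ℝ] at this
    exact (smul_eq_zero.1 this).resolve_left two_ne_zero
  rw [mollify_apply]
  calc ∫ t, b.normed volume t • L (x - t)
      = ∫ t, (b.normed volume t • L x - L (b.normed volume t • t)) := by
        simp only [map_sub, smul_sub, map_smul]
    _ = L x := by
        rw [integral_sub (b.integrable_normed.smul_const _) (L.integrable_comp hi),
          b.integral_normed_smul, L.integral_comp_comm hi, h0, map_zero, sub_zero]

lemma mollify_sub_clm {n : ℕ} (b : ContDiffBump (0 : Euc n)) {F : Euc n → Euc n}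
    (hF : Continuous F) (L : Euc n →L[ℝ] Euc n) (x : Euc n) :
    mollify b (fun z => F z - L z) x = mollify b F x - L x := by
  have hi : ∀ H : Euc n → Euc n, Continuous H →
      Integrable fun t : Euc n => b.normed volume t • H (x - t) := fun H hH =>
    (hH.comp (continuous_const.sub continuous_id)).locallyIntegrable
      |>.integrable_smul_left_of_hasCompactSupport b.continuous_normed b.hasCompactSupport_normed
  rw [← mollify_clm b L x]
  simp only [mollify_apply, smul_sub]
  exact integral_sub (hi F hF) (hi L L.continuous)

/-- The bump function with radii `2⁻¹ ^ j / 2 < 2⁻¹ ^ j`. -/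
def dyadicBump (n j : ℕ) : ContDiffBump (0 : Euc n) where
  rIn := 2⁻¹ ^ j / 2
  rOut := 2⁻¹ ^ j
  rIn_pos := by positivity
  rIn_lt_rOut := half_lt_self (by positivity)

lemma norm_integral_dyadicBump_smul_le {n : ℕ} {E : Type*} [NormedAddCommGroup E]
    [NormedSpace ℝ E] {W : Euc n → E} (hW : LocallyIntegrable W) {j k : ℕ} (hjk : j ≤ k)
    (hkj : k ≤ j + 1) {w x : Euc n} (hw : dist w x ≤ 2⁻¹ ^ j) :
    ‖∫ z, (dyadicBump n k).normed volume (w - z) • W z‖ ≤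
      8 ^ n * ⨍ z in Metric.closedBall x (2 * 2⁻¹ ^ j), ‖W z‖ := by
  have h2 : (2⁻¹ : ℝ) ^ k ≤ 2⁻¹ ^ j := pow_le_pow_of_le_one (by norm_num) (by norm_num) hjk
  have h3 : (2⁻¹ : ℝ) ^ (j + 1) ≤ 2⁻¹ ^ k := pow_le_pow_of_le_one (by norm_num) (by norm_num) hkj
  have hpos : (0 : ℝ) < 2⁻¹ ^ j := by positivity
  refine (norm_integral_normed_smul_le hW (dyadicBump n k) (x := x) (R := 2 * 2⁻¹ ^ j)
    (by simp only [dyadicBump]; linarith)).trans ?_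
  rw [setAverage_eq, smul_eq_mul, ← mul_assoc]
  gcongr
  simp only [dyadicBump]
  rw [Measure.addHaar_real_closedBall _ _ (by positivity),
    Measure.addHaar_real_closedBall _ _ (by positivity), finrank_euclideanSpace, Fintype.card_fin]
  set β := volume.real (Metric.ball (0 : Euc n) 1)
  have hβ : 0 < β := by
    refine ENNReal.toReal_pos (Metric.measure_ball_pos _ _ one_pos).ne' measure_ball_lt_top.ne
  rw [mul_inv, mul_inv, ← mul_assoc]
  gcongr
  rw [← inv_pow, ← inv_pow, ← mul_pow]
  gcongr
  rw [← div_eq_mul_inv, le_div_iff₀ (by positivity), inv_mul_le_iff₀ (by positivity)]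
  rw [pow_succ] at h3
  linarith

lemma HasWeakDerivOn.sub_clm {n : ℕ} {F : Euc n → Euc n}
    {G : Euc n → Euc n →L[ℝ] Euc n} (h : HasWeakDerivOn F G univ) (L : Euc n →L[ℝ] Euc n) :
    HasWeakDerivOn (fun z => F z - L z) (fun z => G z - L) univ := by
  obtain ⟨hF, hG, h⟩ := h
  rw [locallyIntegrableOn_univ] at hF hG
  refine ⟨(hF.sub L.continuous.locallyIntegrable).locallyIntegrableOn _,
    (hG.sub (locallyIntegrable_const L)).locallyIntegrableOn _, fun η hη hηc hs v => ?_⟩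
  have e := h η hη hηc hs v
  rw [Measure.restrict_univ] at e ⊢
  have hη1 : Continuous fun x => fderiv ℝ η x v :=
    (hη.continuous_fderiv (by simp)).clm_apply continuous_const
  have hη1c : HasCompactSupport fun x => fderiv ℝ η x v := hηc.fderiv_apply ℝ v
  have hGv : LocallyIntegrable fun x => G x v := fun x => by
    obtain ⟨u, hu, hi⟩ := hG x
    exact ⟨u, hu, hi.apply_continuousLinearMap v⟩
  have i1 : Integrable fun x => fderiv ℝ η x v • F x :=
    hF.integrable_smul_left_of_hasCompactSupport hη1 hη1c
  have i2 : Integrable fun x => fderiv ℝ η x v • L x :=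
    L.continuous.locallyIntegrable.integrable_smul_left_of_hasCompactSupport hη1 hη1c
  have i3 : Integrable fun x => η x • G x v :=
    hGv.integrable_smul_left_of_hasCompactSupport hη.continuous hηc
  have i4 : Integrable fun x => η x • L v :=
    (locallyIntegrable_const _).integrable_smul_left_of_hasCompactSupport hη.continuous hηc
  have e2 : ∫ x, fderiv ℝ η x v • L x = - ∫ x, η x • L v := by
    have := integral_bilinear_hasFDerivAt_right_eq_neg_left_of_integrable (μ := volume)
      (f := η) (f' := fderiv ℝ η) (g := L) (g' := fun _ => L) (v := v)
      (B := ContinuousLinearMap.lsmul ℝ ℝ) i2 i4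
      ((hη.continuous.smul L.continuous).integrable_of_hasCompactSupport hηc.smul_right)
      (fun x _ => (hη.differentiable (by simp) x).hasFDerivAt) (fun x _ => L.hasFDerivAt)
    simp only [ContinuousLinearMap.lsmul_apply] at this
    rw [this, neg_neg]
  simp only [smul_sub, sub_apply]
  rw [integral_sub i1 i2, integral_sub i3 i4, e, e2]
  abel

lemma HasWeakDerivOn.norm_mollify_sub_le {n : ℕ} {F : Euc n → Euc n}
    {G : Euc n → Euc n →L[ℝ] Euc n} (h : HasWeakDerivOn F G univ) {j k : ℕ} (hjk : j ≤ k)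
    (hkj : k ≤ j + 1) {w x : Euc n} (hw : dist w x ≤ 2⁻¹ ^ j) :
    ‖mollify (dyadicBump n k) F w - mollify (dyadicBump n k) F x‖ ≤
      8 ^ n * (⨍ z in Metric.closedBall x (2 * 2⁻¹ ^ j), ‖G z‖) * ‖w - x‖ := by
  refine (convex_closedBall x ((2 : ℝ)⁻¹ ^ j)).norm_image_sub_le_of_norm_hasFDerivWithin_le
    (fun y _ => (h.hasFDerivAt_mollify (dyadicBump n k) y).hasFDerivWithinAt)
    (fun y hy => ?_) (Metric.mem_closedBall_self (by positivity)) hw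
  exact norm_integral_dyadicBump_smul_le (locallyIntegrableOn_univ.1 h.2.1) hjk hkj hy

lemma HasWeakDerivOn.dist_mollify_self_le {n : ℕ} {F : Euc n → Euc n} (hF : Continuous F)
    {G : Euc n → Euc n →L[ℝ] Euc n} (h : HasWeakDerivOn F G univ) {x : Euc n} {ε : ℝ} {j₀ : ℕ}
    (hε : ∀ j ≥ j₀, ⨍ z in Metric.closedBall x (2 * 2⁻¹ ^ j), ‖G z‖ ≤ ε) :
    dist (mollify (dyadicBump n j₀) F x) (F x) ≤ 4 * 8 ^ n * ε * 2⁻¹ ^ j₀ := by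
  have hmcont : ∀ k, Continuous (mollify (dyadicBump n k) F) := fun k =>
    continuous_iff_continuousAt.2 fun y =>
      (h.hasFDerivAt_mollify (dyadicBump n k) y).continuousAt
  have hε0 : 0 ≤ ε := (integral_nonneg fun z => norm_nonneg _).trans (hε j₀ le_rfl)
  have hosc : ∀ j ≥ j₀, ∀ k l, j ≤ k → k ≤ j + 1 → j ≤ l →
      dist (mollify (dyadicBump n l) (mollify (dyadicBump n k) F) x)
        (mollify (dyadicBump n k) F x) ≤ 8 ^ n * ε * 2⁻¹ ^ j := by
    intro j hj k l hjk hkj hl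
    refine ContDiffBump.dist_normed_convolution_le (hmcont k).aestronglyMeasurable
      fun w hw => ?_
    have hw' : dist w x ≤ 2⁻¹ ^ j := by
      refine (Metric.mem_ball.1 hw).le.trans ?_
      exact pow_le_pow_of_le_one (by norm_num) (by norm_num) hl
    rw [dist_eq_norm]
    refine (h.norm_mollify_sub_le hjk hkj hw').trans ?_
    rw [← dist_eq_norm]
    gcongr
    exact hε j hj
  have hstep : ∀ j ≥ j₀, dist (mollify (dyadicBump n j) F x) (mollify (dyadicBump n (j + 1)) F x)
      ≤ 2 * (8 ^ n * ε * 2⁻¹ ^ j) := by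
    intro j hj
    have h1 := hosc j hj j (j + 1) le_rfl (by lia) (by lia)
    have h2 := hosc j hj (j + 1) j (by lia) le_rfl le_rfl
    rw [mollify_comm _ _ hF] at h1
    rw [dist_comm] at h1
    linarith [dist_triangle (mollify (dyadicBump n j) F x)
      (mollify (dyadicBump n j) (mollify (dyadicBump n (j + 1)) F) x)
      (mollify (dyadicBump n (j + 1)) F x)]
  refine dist_le_of_le_geometric_two_of_tendsto₀
    (f := fun i => mollify (dyadicBump n (j₀ + i)) F x) (fun i => ?_) ?_
  · refine (hstep (j₀ + i) (by lia)).trans (le_of_eq ?_)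
    rw [pow_add, inv_pow _ i]
    ring
  · refine ContDiffBump.convolution_tendsto_right_of_continuous ?_ hF x
    have := (tendsto_pow_atTop_nhds_zero_of_lt_one (r := (2 : ℝ)⁻¹) (by norm_num)
      (by norm_num)).comp (tendsto_add_atTop_nat j₀)
    simpa [dyadicBump, Function.comp_def, add_comm] using this

lemma HasWeakDerivOn.norm_sub_sub_le {n : ℕ} {F : Euc n → Euc n} (hF : Continuous F)
    {G : Euc n → Euc n →L[ℝ] Euc n} (h : HasWeakDerivOn F G univ) {x y : Euc n} {ε : ℝ} {j₀ : ℕ}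
    (hx : ∀ j ≥ j₀, ⨍ z in Metric.closedBall x (2 * 2⁻¹ ^ j), ‖G z - G x‖ ≤ ε)
    (hy : ∀ j ≥ j₀, ⨍ z in Metric.closedBall y (2 * 2⁻¹ ^ j), ‖G z - G y‖ ≤ ε)
    (hxy : dist y x ≤ 2⁻¹ ^ j₀) :
    ‖F y - F x - G x (y - x)‖ ≤ 17 * 8 ^ n * ε * ‖y - x‖ := by
  rcases eq_or_ne y x with rfl | hne
  · simp
  have hd : 0 < dist y x := dist_pos.2 hne
  have hε0 : 0 ≤ ε := (integral_nonneg fun z => norm_nonneg _).trans (hx j₀ le_rfl)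
  obtain ⟨i, hi1, hi2⟩ := exists_nat_pow_near_of_lt_one hd
    (hxy.trans (pow_le_one₀ (by norm_num) (by norm_num))) (y := (2 : ℝ)⁻¹) (by norm_num)
      (by norm_num)
  set j := max i j₀ with hj
  have hdj : dist y x ≤ 2⁻¹ ^ j := by
    rcases max_choice i j₀ with h | h <;> rw [hj, h] <;> assumption
  have hdj' : (2⁻¹ : ℝ) ^ j ≤ 2 * dist y x := by
    have : (2⁻¹ : ℝ) ^ j ≤ 2⁻¹ ^ i :=
      pow_le_pow_of_le_one (by norm_num) (by norm_num) (le_max_left _ _)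
    rw [pow_succ] at hi1
    linarith
  have hself : ∀ u, (∀ j ≥ j₀, ⨍ z in Metric.closedBall u (2 * 2⁻¹ ^ j), ‖G z - G u‖ ≤ ε) →
      ‖mollify (dyadicBump n j) F u - F u‖ ≤ 4 * 8 ^ n * ε * 2⁻¹ ^ j := by
    intro u hu
    have := HasWeakDerivOn.dist_mollify_self_le (F := fun z => F z - G u z)
      (hF.sub (G u).continuous) (h.sub_clm (G u)) (x := u) (j₀ := j)
      (fun k hk => hu k ((le_max_right _ _).trans hk))
    rwa [mollify_sub_clm _ hF, dist_eq_norm, sub_sub_sub_cancel_right] at this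
  have hmid := (h.sub_clm (G x)).norm_mollify_sub_le (k := j) le_rfl (by lia) hdj
  rw [mollify_sub_clm _ hF, mollify_sub_clm _ hF] at hmid
  replace hmid := hmid.trans (mul_le_mul_of_nonneg_right (mul_le_mul_of_nonneg_left
    (hx j (le_max_right _ _)) (by positivity)) (norm_nonneg _))
  have hX := hself x hx
  have hY := hself y hy
  rw [dist_eq_norm] at hdj'
  have hC : 0 ≤ 4 * 8 ^ n * ε := by positivity
  set m := mollify (dyadicBump n j) F
  calc ‖F y - F x - G x (y - x)‖
      = ‖(m y - G x y - (m x - G x x)) - (m y - F y) + (m x - F x)‖ := by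
        rw [map_sub]; congr 1; abel
    _ ≤ ‖m y - G x y - (m x - G x x)‖ + ‖m y - F y‖ + ‖m x - F x‖ :=
        (norm_add_le _ _).trans (by gcongr; exact norm_sub_le _ _)
    _ ≤ 8 ^ n * ε * ‖y - x‖ + 4 * 8 ^ n * ε * (2 * ‖y - x‖) + 4 * 8 ^ n * ε * (2 * ‖y - x‖) := by
        gcongr
        · exact hY.trans (by gcongr)
        · exact hX.trans (by gcongr)
    _ = 17 * 8 ^ n * ε * ‖y - x‖ := by ring

lemma stronglyMeasurable_setAverage_norm_sub {n : ℕ} {E : Type*} [NormedAddCommGroup E]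
    {G : Euc n → E} (hG : StronglyMeasurable G) (r : ℝ) :
    StronglyMeasurable fun x => ⨍ z in Metric.closedBall x r, ‖G z - G x‖ := by
  have hs : MeasurableSet {p : Euc n × Euc n | dist p.2 p.1 ≤ r} :=
    (isClosed_le (by fun_prop) continuous_const).measurableSet
  have h1 : StronglyMeasurable fun p : Euc n × Euc n =>
      {p : Euc n × Euc n | dist p.2 p.1 ≤ r}.indicator (fun p => ‖G p.2 - G p.1‖) p :=
    (((hG.comp_measurable measurable_snd).sub
      (hG.comp_measurable measurable_fst)).norm).indicator hs
  have h2 := h1.integral_prod_right' (ν := volume)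
  convert h2.const_smul ((volume.real (Metric.closedBall (0 : Euc n) r))⁻¹) using 2 with x
  rw [setAverage_eq, ← integral_indicator measurableSet_closedBall, Pi.smul_apply, measureReal_def,
    Measure.addHaar_closedBall_center, ← measureReal_def]
  rfl

/-- A continuous map with a locally integrable weak differential is, up to a null set, covered by
countably many measurable sets on each of which it is differentiable, with differential the weak
one. -/
theorem HasWeakDerivOn.exists_hasFDerivWithinAt {n : ℕ} {F : Euc n → Euc n} (hF : Continuous F)
    {G : Euc n → Euc n →L[ℝ] Euc n} (hGm : StronglyMeasurable G) (h : HasWeakDerivOn F G univ) :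
    ∃ s : ℕ → Set (Euc n), (∀ k, MeasurableSet (s k)) ∧ volume (⋃ k, s k)ᶜ = 0 ∧
      ∀ k, ∀ x ∈ s k, HasFDerivWithinAt F (G x) (s k) x := by
  have hlim : ∀ᵐ x : Euc n, Tendsto
      (fun j : ℕ => ⨍ z in Metric.closedBall x (2 * 2⁻¹ ^ j), ‖G z - G x‖) atTop (nhds 0) := by
    filter_upwards [IsUnifLocDoublingMeasure.ae_tendsto_average_norm_sub volume
      (locallyIntegrableOn_univ.1 h.2.1) 1] with x hx
    refine hx (fun _ => x) _ ?_ (Eventually.of_forall fun j =>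
      Metric.mem_closedBall_self (by positivity))
    refine tendsto_nhdsWithin_iff.2 ⟨?_, Eventually.of_forall fun j => ?_⟩
    · simpa using (tendsto_pow_atTop_nhds_zero_of_lt_one (r := (2 : ℝ)⁻¹) (by norm_num)
        (by norm_num)).const_mul 2
    · simp
  have hegorov := fun N K : ℕ => tendstoUniformlyOn_of_ae_tendsto (μ := volume)
    (fun j : ℕ => stronglyMeasurable_setAverage_norm_sub hGm (2 * 2⁻¹ ^ j))
    (stronglyMeasurable_const (b := (0 : ℝ)))
    (measurableSet_closedBall (x := (0 : Euc n)) (ε := N)) measure_closedBall_lt_top.ne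
    (hlim.mono fun x hx _ => hx) (ε := 1 / ((K : ℝ) + 1)) (by positivity)
  choose t hts htm hμt hunif using hegorov
  set s : ℕ × ℕ → Set (Euc n) := fun p => Metric.closedBall 0 p.1 \ t p.1 p.2 with hs
  have hsd : ∀ p, ∀ x ∈ s p, HasFDerivWithinAt F (G x) (s p) x := by
    intro p x hx
    refine .of_isLittleO (Asymptotics.isLittleO_iff.2 fun c hc => ?_)
    have hε : 0 < c / (17 * 8 ^ n) := by positivity
    obtain ⟨j₀, hj₀⟩ := eventually_atTop.1
      (Metric.tendstoUniformlyOn_iff.1 (hunif p.1 p.2) _ hε)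
    have hbd : ∀ u ∈ s p, ∀ j ≥ j₀,
        ⨍ z in Metric.closedBall u (2 * 2⁻¹ ^ j), ‖G z - G u‖ ≤ c / (17 * 8 ^ n) := by
      intro u hu j hj
      have := hj₀ j hj u hu
      rw [dist_comm, Real.dist_0_eq_abs] at this
      exact (le_abs_self _).trans this.le
    have hnear : Metric.closedBall x (2⁻¹ ^ j₀) ∈ nhdsWithin x (s p) :=
      mem_nhdsWithin_of_mem_nhds (Metric.closedBall_mem_nhds _ (by positivity))
    filter_upwards [self_mem_nhdsWithin, hnear] with y hy hyx
    refine (h.norm_sub_sub_le hF (hbd x hx) (hbd y hy) hyx).trans (le_of_eq ?_)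
    field_simp
  have hcover : volume (⋃ p, s p)ᶜ = 0 := by
    have hsub : ∀ N : ℕ, volume ((⋃ p, s p)ᶜ ∩ Metric.closedBall 0 N) = 0 := by
      intro N
      refine le_antisymm (ge_of_tendsto' (x := atTop)
        (f := fun K : ℕ => ENNReal.ofReal (1 / ((K : ℝ) + 1))) ?_ fun K => ?_) zero_le
      · simpa using ENNReal.tendsto_ofReal tendsto_one_div_add_atTop_nhds_zero_nat
      · refine (measure_mono fun x hx => ?_).trans (hμt N K)
        by_contra hxt
        exact hx.1 (mem_iUnion.2 ⟨(N, K), hx.2, hxt⟩)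
    refine measure_mono_null (t := ⋃ N : ℕ, (⋃ p, s p)ᶜ ∩ Metric.closedBall 0 N)
      (fun x hx => ?_) (measure_iUnion_null hsub)
    obtain ⟨N, hN⟩ := exists_nat_ge ‖x‖
    exact mem_iUnion.2 ⟨N, hx, by simpa using hN⟩
  refine ⟨fun k => s (Nat.pairEquiv.symm k), fun k => measurableSet_closedBall.diff (htm _ _),
    ?_, fun k => hsd _⟩
  rwa [Nat.pairEquiv.symm.surjective.iUnion_comp s]

lemma ofReal_abs_det_le {n : ℕ} (L : Euc n →L[ℝ] Euc n) :
    ENNReal.ofReal |LinearMap.det (L : Euc n →ₗ[ℝ] Euc n)| ≤ (‖L‖₊ : ℝ≥0∞) ^ n := by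
  set β := volume (Metric.closedBall (0 : Euc n) 1)
  have h0 : β ≠ 0 := (Metric.measure_closedBall_pos _ _ one_pos).ne'
  have ht : β ≠ ∞ := measure_closedBall_lt_top.ne
  have hsub : L '' Metric.closedBall 0 1 ⊆ Metric.closedBall 0 ‖L‖ := by
    rintro _ ⟨x, hx, rfl⟩
    rw [mem_closedBall_zero_iff] at hx ⊢
    exact (L.le_opNorm x).trans (mul_le_of_le_one_right (norm_nonneg _) hx)
  have h1 := measure_mono (μ := volume) hsub
  rw [Measure.addHaar_image_continuousLinearMap,
    Measure.addHaar_closedBall' volume _ (norm_nonneg _), finrank_euclideanSpace,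
    Fintype.card_fin] at h1
  replace h1 := (ENNReal.mul_le_mul_iff_left h0 ht).1 h1
  rwa [ENNReal.ofReal_pow (norm_nonneg _), ofReal_norm] at h1

lemma IsHomeoOn.isOpen_inter_preimage {n : ℕ} {φ : Euc n → Euc n} {Ω Ω' U : Set (Euc n)}
    (hφ : IsHomeoOn φ Ω Ω') (hΩ : IsOpen Ω) (hU : IsOpen U) : IsOpen (Ω ∩ φ ⁻¹' U) :=
  hφ.2.1.isOpen_inter_preimage hΩ hU

lemma IsHomeoOn.measurableSet_inter_preimage {n : ℕ} {φ : Euc n → Euc n} {Ω Ω' B : Set (Euc n)}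
    (hφ : IsHomeoOn φ Ω Ω') (hΩ : IsOpen Ω) (hB : MeasurableSet B) :
    MeasurableSet (Ω ∩ φ ⁻¹' B) := by
  have h : Measurable (Ω.piecewise φ fun _ => 0) :=
    hφ.2.1.measurable_piecewise continuousOn_const hΩ.measurableSet
  convert hΩ.measurableSet.inter (h hB) using 1
  ext x
  by_cases hx : x ∈ Ω <;> simp [hx]

lemma IsHomeoOn.invFunOn_apply {n : ℕ} {φ : Euc n → Euc n} {Ω Ω' : Set (Euc n)}
    (hφ : IsHomeoOn φ Ω Ω') {x : Euc n} (hx : x ∈ Ω) : Function.invFunOn φ Ω (φ x) = x :=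
  hφ.1.injOn.leftInvOn_invFunOn hx

lemma IsHomeoOn.isCompact_inter_preimage {n : ℕ} {φ : Euc n → Euc n} {Ω Ω' K : Set (Euc n)}
    (hφ : IsHomeoOn φ Ω Ω') (hK : IsCompact K) (hKΩ : K ⊆ Ω') : IsCompact (Ω ∩ φ ⁻¹' K) := by
  have : Ω ∩ φ ⁻¹' K = Function.invFunOn φ Ω '' K := by
    ext x
    constructor
    · rintro ⟨hx, hxK⟩
      exact ⟨φ x, hxK, hφ.invFunOn_apply hx⟩
    · rintro ⟨y, hy, rfl⟩
      have hy' := hφ.1.surjOn (hKΩ hy)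
      exact ⟨Function.invFunOn_mem hy', by rwa [mem_preimage, Function.invFunOn_eq hy']⟩
  rw [this]
  exact hK.image_of_continuousOn (hφ.2.2.mono hKΩ)

lemma volDerivInv_le_rnDeriv {n : ℕ} [NeZero n] {φ : Euc n → Euc n} {Ω U : Set (Euc n)}
    (hU : IsOpen U) (hW : MeasurableSet (Ω ∩ φ ⁻¹' U)) (hWt : volume (Ω ∩ φ ⁻¹' U) ≠ ∞)
    (hφ : AEMeasurable φ (volume.restrict (Ω ∩ φ ⁻¹' U))) :
    ∀ᵐ y, y ∈ U → volDerivInv φ Ω y ≤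
      ((volume.restrict (Ω ∩ φ ⁻¹' U)).map φ).rnDeriv volume y := by
  have : IsFiniteMeasure (volume.restrict (Ω ∩ φ ⁻¹' U)) := ⟨by simpa using hWt.lt_top⟩
  obtain ⟨ν, hν⟩ : ∃ ν, ν = (volume.restrict (Ω ∩ φ ⁻¹' U)).map φ := ⟨_, rfl⟩
  have : IsFiniteMeasure ν := hν ▸ inferInstance
  rw [← hν]
  have : Nonempty (Fin n) := ⟨0⟩
  filter_upwards [Besicovitch.ae_tendsto_rnDeriv ν volume] with y hy hyU
  rw [← hy.limsup_eq, volDerivInv]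
  refine limsup_le_limsup ?_
  obtain ⟨δ, hδ, hball⟩ := Metric.isOpen_iff.1 hU y hyU
  filter_upwards [Ioo_mem_nhdsGT hδ] with r hr
  rw [Measure.addHaar_closedBall_eq_addHaar_ball volume y r]
  refine ENNReal.div_le_div_right ?_ _
  rw [hν, Measure.map_apply_of_aemeasurable hφ measurableSet_closedBall,
    Measure.restrict_apply' hW]
  refine measure_mono fun x ⟨hxΩ, hx⟩ => ?_
  have hx : dist (φ x) y < r := hx
  exact ⟨hx.le, hxΩ, hball (Metric.mem_ball.2 (hx.trans hr.2))⟩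

/-- The reciprocal of the Jacobian at `φ⁻¹(y)`, set to `0` where `φ⁻¹(y)` lies in `S` or in the
zero set of the Jacobian. -/
def invJacobianInv {n : ℕ} (D : Euc n → Euc n →L[ℝ] Euc n) (φ : Euc n → Euc n)
    (Ω S : Set (Euc n)) (y : Euc n) : ℝ≥0∞ :=
  if Function.invFunOn φ Ω y ∈ Ω \ (S ∪ {x | jacobian D x = 0}) then
    (ENNReal.ofReal |jacobian D (Function.invFunOn φ Ω y)|)⁻¹
  else 0

lemma measurable_jacobian {n : ℕ} {D : Euc n → Euc n →L[ℝ] Euc n} (hD : Measurable D) :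
    Measurable (jacobian D) :=
  ContinuousLinearMap.continuous_det.measurable.comp hD

lemma IsHomeoOn.measure_le_setLIntegral_inv_jacobian {n : ℕ} {φ : Euc n → Euc n}
    {Ω Ω' s : Set (Euc n)} (hφ : IsHomeoOn φ Ω Ω') (hsΩ : s ⊆ Ω) (hs : MeasurableSet s)
    {D : Euc n → Euc n →L[ℝ] Euc n}
    (hd : ∀ x ∈ s, HasFDerivWithinAt φ (D x) s x) (hJ : ∀ x ∈ s, jacobian D x ≠ 0) :
    volume s = ∫⁻ y in φ '' s,
      (ENNReal.ofReal |jacobian D (Function.invFunOn φ Ω y)|)⁻¹ := by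
  rw [lintegral_image_eq_lintegral_abs_det_fderiv_mul volume hs hd (hφ.1.injOn.mono hsΩ),
    ← setLIntegral_one]
  refine setLIntegral_congr_fun hs fun x hx => ?_
  rw [hφ.invFunOn_apply (hsΩ hx)]
  exact (ENNReal.mul_inv_cancel (by simpa [jacobian] using hJ x hx) ENNReal.ofReal_ne_top).symm

lemma IsHomeoOn.rnDeriv_le_invJacobianInv {n : ℕ} {φ : Euc n → Euc n} {Ω Ω' U : Set (Euc n)}
    (hφ : IsHomeoOn φ Ω Ω') (hΩ : IsOpen Ω) (hUΩ : U ⊆ Ω')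
    (hW : MeasurableSet (Ω ∩ φ ⁻¹' U)) (hWt : volume (Ω ∩ φ ⁻¹' U) ≠ ∞)
    (hφm : AEMeasurable φ (volume.restrict (Ω ∩ φ ⁻¹' U)))
    {D : Euc n → Euc n →L[ℝ] Euc n} (hD : Measurable D) {s : ℕ → Set (Euc n)}
    (hsm : ∀ k, MeasurableSet (s k)) (hsΩ : ∀ k, s k ⊆ Ω)
    (hd : ∀ k, ∀ x ∈ s k, HasFDerivWithinAt φ (D x) (s k) x)
    (hS : volume (Ω \ ⋃ k, s k) = 0) :
    ∀ᵐ y, y ∈ U → ((volume.restrict (Ω ∩ φ ⁻¹' U)).map φ).rnDeriv volume y ≤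
      invJacobianInv D φ Ω (Ω \ ⋃ k, s k) y := by
  set ν := (volume.restrict (Ω ∩ φ ⁻¹' U)).map φ with hν
  set S := Ω \ ⋃ k, s k with hSdef
  set Z := {x | jacobian D x = 0} with hZ
  have hZm : MeasurableSet Z := measurable_jacobian hD (measurableSet_singleton 0)
  have hSm : MeasurableSet S := hΩ.measurableSet.diff (MeasurableSet.iUnion hsm)
  have : IsFiniteMeasure (volume.restrict (Ω ∩ φ ⁻¹' U)) := ⟨by simpa using hWt.lt_top⟩
  have himage : ∀ t ⊆ Ω, MeasurableSet t → MeasurableSet (φ '' t) := fun t ht htm =>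
    htm.image_of_continuousOn_injOn (hφ.2.1.mono ht) (hφ.1.injOn.mono ht)
  have hνimage : ∀ t ⊆ Ω, MeasurableSet t → ν (φ '' t) ≤ volume t := by
    intro t ht htm
    rw [hν, Measure.map_apply_of_aemeasurable hφm (himage t ht htm), Measure.restrict_apply' hW]
    refine measure_mono ?_
    rintro x ⟨⟨z, hz, hzx⟩, hx, -⟩
    rwa [← hφ.1.injOn (ht hz) hx hzx]
  have hae1 : ∀ᵐ y, y ∈ φ '' S → ν.rnDeriv volume y = 0 := by
    have h0 : ∫⁻ y in φ '' S, ν.rnDeriv volume y = 0 :=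
      le_antisymm ((Measure.setLIntegral_rnDeriv_le _).trans
        ((hνimage S sdiff_subset hSm).trans hS.le)) zero_le
    rw [lintegral_eq_zero_iff (Measure.measurable_rnDeriv _ _)] at h0
    exact (ae_restrict_iff' (himage S sdiff_subset hSm)).1 h0
  have hae2 : ∀ k, ∀ᵐ y, y ∉ φ '' (s k ∩ Z) := fun k => by
    refine measure_eq_zero_iff_ae_notMem.1 ?_
    exact addHaar_image_eq_zero_of_det_fderivWithin_eq_zero (f' := D) volume
      (fun x hx => (hd k x hx.1).mono inter_subset_left) fun x hx => hx.2
  have hae3 : ∀ k, ∀ᵐ y, y ∈ φ '' (s k \ Z) → ν.rnDeriv volume y ≤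
      (ENNReal.ofReal |jacobian D (Function.invFunOn φ Ω y)|)⁻¹ := fun k => by
    have hsub : s k \ Z ⊆ Ω := sdiff_subset.trans (hsΩ k)
    have hm : MeasurableSet (φ '' (s k \ Z)) := himage _ hsub ((hsm k).diff hZm)
    refine (ae_restrict_iff' hm).1 (ae_le_of_forall_setLIntegral_le_of_sigmaFinite
      (Measure.measurable_rnDeriv _ _) fun B hB _ => ?_)
    rw [Measure.restrict_restrict hB]
    set t := s k \ Z ∩ (Ω ∩ φ ⁻¹' B) with ht
    have htm : MeasurableSet t :=
      ((hsm k).diff hZm).inter (hφ.measurableSet_inter_preimage hΩ hB)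
    have htΩ : t ⊆ Ω := inter_subset_left.trans hsub
    have hBt : B ∩ φ '' (s k \ Z) = φ '' t := by
      ext y
      constructor
      · rintro ⟨hyB, x, hx, rfl⟩
        exact ⟨x, ⟨hx, hsub hx, hyB⟩, rfl⟩
      · rintro ⟨x, ⟨hx, -, hxB⟩, rfl⟩
        exact ⟨hxB, x, hx, rfl⟩
    rw [hBt, ← hφ.measure_le_setLIntegral_inv_jacobian htΩ htm
      (fun x hx => (hd k x hx.1.1).mono (inter_subset_left.trans sdiff_subset))
      fun x hx => hx.1.2]
    exact (Measure.setLIntegral_rnDeriv_le _).trans (hνimage t htΩ htm)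
  filter_upwards [hae1, ae_all_iff.2 hae2, ae_all_iff.2 hae3] with y h1 h2 h3 hyU
  have hy := hφ.1.surjOn (hUΩ hyU)
  obtain ⟨x, hx, rfl⟩ := hy
  rw [invJacobianInv, hφ.invFunOn_apply hx] at *
  by_cases hxS : x ∈ S
  · simp [h1 ⟨x, hxS, rfl⟩]
  · obtain ⟨k, hk⟩ := mem_iUnion.1 (by_contra fun hk => hxS ⟨hx, hk⟩)
    have hxZ : x ∉ Z := fun hxZ => h2 k ⟨x, ⟨hk, hxZ⟩, rfl⟩
    rw [if_pos ⟨hx, fun h => h.elim hxS hxZ⟩]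
    exact h3 k ⟨x, ⟨hk, hxZ⟩, rfl⟩

/-- The volume derivative of the inverse is a.e. bounded by the reciprocal of the Jacobian. -/
theorem IsHomeoOn.volDerivInv_le_invJacobianInv {n : ℕ} [NeZero n] {φ : Euc n → Euc n}
    {Ω Ω' : Set (Euc n)} (hφ : IsHomeoOn φ Ω Ω') (hΩ : IsOpen Ω) (hΩ' : IsOpen Ω')
    {D : Euc n → Euc n →L[ℝ] Euc n} (hD : Measurable D) {s : ℕ → Set (Euc n)}
    (hsm : ∀ k, MeasurableSet (s k)) (hsΩ : ∀ k, s k ⊆ Ω)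
    (hd : ∀ k, ∀ x ∈ s k, HasFDerivWithinAt φ (D x) (s k) x)
    (hS : volume (Ω \ ⋃ k, s k) = 0) :
    ∀ᵐ y ∂(volume.restrict Ω'),
      volDerivInv φ Ω y ≤ invJacobianInv D φ Ω (Ω \ ⋃ k, s k) y := by
  rw [ae_restrict_iff' hΩ'.measurableSet, ae_iff]
  refine measure_null_of_locally_null _ fun y hy => ?_
  have hyΩ : y ∈ Ω' := by by_contra hyΩ; exact hy fun h => absurd h hyΩ
  obtain ⟨r, hr, hball⟩ := Metric.nhds_basis_closedBall.mem_iff.1 (hΩ'.mem_nhds hyΩ)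
  have hUΩ : Metric.ball y r ⊆ Ω' := Metric.ball_subset_closedBall.trans hball
  have hW : IsOpen (Ω ∩ φ ⁻¹' Metric.ball y r) := hφ.isOpen_inter_preimage hΩ Metric.isOpen_ball
  have hWt : volume (Ω ∩ φ ⁻¹' Metric.ball y r) ≠ ∞ :=
    (measure_mono_top (inter_subset_inter_right _ (preimage_mono Metric.ball_subset_closedBall))).mt
      (hφ.isCompact_inter_preimage (isCompact_closedBall y r) hball).measure_ne_top
  have hφm : AEMeasurable φ (volume.restrict (Ω ∩ φ ⁻¹' Metric.ball y r)) :=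
    (hφ.2.1.mono inter_subset_left).aemeasurable hW.measurableSet
  refine ⟨_, inter_mem_nhdsWithin _ (Metric.ball_mem_nhds y hr), ?_⟩
  rw [← nonpos_iff_eq_zero]
  have h := (volDerivInv_le_rnDeriv Metric.isOpen_ball hW.measurableSet hWt hφm).and
    (hφ.rnDeriv_le_invJacobianInv hΩ hUΩ hW.measurableSet hWt hφm hD hsm hsΩ hd hS)
  refine (measure_mono ?_).trans (ae_iff.1 h).le
  rintro z ⟨hz, hzU⟩ hcon
  exact hz fun _ => (hcon.1 hzU).trans (hcon.2 hzU)

lemma invJacobianInv_le_distortionH {n : ℕ} {q : ℝ} (hq : 1 ≤ q) (hqn : q < n)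
    (D : Euc n → Euc n →L[ℝ] Euc n) (φ : Euc n → Euc n) (Ω S : Set (Euc n)) (y : Euc n) :
    invJacobianInv D φ Ω S y ≤
      distortionH D φ Ω S q y ^ ((n : ℝ) * q / ((n : ℝ) - q)) := by
  rw [invJacobianInv, distortionH]
  split_ifs with hx
  swap
  · exact zero_le
  set x := Function.invFunOn φ Ω y
  have hJ0 : jacobian D x ≠ 0 := fun h => hx.2 (Or.inr h)
  have hdet : ENNReal.ofReal |jacobian D x| ≤ (‖D x‖₊ : ℝ≥0∞) ^ n := ofReal_abs_det_le (D x)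
  set J := ENNReal.ofReal |jacobian D x|
  have hJ : J ≠ 0 := by simpa [J] using hJ0
  have hJt : J ≠ ∞ := ENNReal.ofReal_ne_top
  have hnq : 0 < (n : ℝ) - q := sub_pos.2 hqn
  have hq0 : 0 < q := one_pos.trans_le hq
  have hn : (n : ℝ) ≠ 0 := (hq0.trans hqn).ne'
  rw [← ENNReal.rpow_mul, ← ENNReal.rpow_natCast] at *
  have hdq : J ^ (q / n) ≤ (‖D x‖₊ : ℝ≥0∞) ^ q := by
    have := ENNReal.rpow_le_rpow hdet (z := q / n) (by positivity)
    rwa [← ENNReal.rpow_mul, mul_div_cancel₀ _ hn] at this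
  calc J⁻¹ = (J ^ (q / n) / J) ^ (1 / q * (n * q / (n - q))) := by
        rw [← ENNReal.rpow_neg_one, div_eq_mul_inv, ← ENNReal.rpow_neg_one J,
          ← ENNReal.rpow_add _ _ hJ hJt, ← ENNReal.rpow_mul]
        congr 1
        field_simp
        ring
    _ ≤ _ := by gcongr

open scoped Manifold in
lemma exists_contDiff_cutoff {n : ℕ} {K Ω : Set (Euc n)} (hK : IsCompact K) (hΩ : IsOpen Ω)
    (hKΩ : K ⊆ Ω) :
    ∃ χ : Euc n → ℝ, ContDiff ℝ (⊤ : ℕ∞) χ ∧ HasCompactSupport χ ∧ tsupport χ ⊆ Ω ∧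
      ∀ᶠ x in nhdsSet K, χ x = 1 := by
  obtain ⟨L, hL, hKL, hLΩ⟩ := exists_compact_between hK hΩ hKΩ
  obtain ⟨f, h1, h0, -⟩ := exists_contMDiffMap_one_nhds_of_subset_interior
    (n := ⊤) 𝓘(ℝ, Euc n) hK.isClosed hKL
  have hsub : tsupport f ⊆ L :=
    closure_minimal (Function.support_subset_iff'.2 h0) hL.isClosed
  exact ⟨f, f.contMDiff.contDiff, hL.of_isClosed_subset (isClosed_tsupport _) hsub,
    hsub.trans hLΩ, h1⟩

lemma ContDiff.hasWeakGradientOn {n : ℕ} {f : Euc n → ℝ} (hf : ContDiff ℝ (⊤ : ℕ∞) f)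
    (Ω : Set (Euc n)) : HasWeakGradientOn f (gradient f) Ω := by
  have hg : Continuous (gradient f) :=
    (InnerProductSpace.toDual ℝ (Euc n)).symm.continuous.comp (hf.continuous_fderiv (by simp))
  refine ⟨hf.continuous.locallyIntegrable.locallyIntegrableOn _,
    hg.locallyIntegrable.locallyIntegrableOn _, fun η hη hηc hηΩ v => ?_⟩
  have hη0 : ∀ x ∉ Ω, η x = 0 := fun x hx => image_eq_zero_of_notMem_tsupport fun h => hx (hηΩ h)
  have hη1 : ∀ x ∉ Ω, fderiv ℝ η x = 0 := fun x hx =>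
    image_eq_zero_of_notMem_tsupport fun h => hx (hηΩ (tsupport_fderiv_subset ℝ h))
  rw [setIntegral_eq_integral_of_forall_compl_eq_zero (fun x hx => by simp [hη1 x hx]),
    setIntegral_eq_integral_of_forall_compl_eq_zero (fun x hx => by simp [hη0 x hx])]
  have hη' : Continuous fun x => fderiv ℝ η x v :=
    (hη.continuous_fderiv (by simp)).clm_apply continuous_const
  have hf' : Continuous fun x => fderiv ℝ f x v :=
    (hf.continuous_fderiv (by simp)).clm_apply continuous_const
  rw [integral_mul_fderiv_eq_neg_fderiv_mul_of_integrable]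
  · simp [gradient, InnerProductSpace.toDual_symm_apply]
  · exact (hf'.mul hη.continuous).integrable_of_hasCompactSupport hηc.mul_left
  · exact (hf.continuous.mul hη').integrable_of_hasCompactSupport (hηc.fderiv_apply ℝ v).mul_left
  · exact (hf.continuous.mul hη.continuous).integrable_of_hasCompactSupport hηc.mul_left
  · exact fun x _ => hf.differentiable (by simp) x
  · exact fun x _ => hη.differentiable (by simp) x

lemma lpNormE_gradient_ne_top {n : ℕ} (hn : n ≠ 0) {f : Euc n → ℝ} (hf : ContDiff ℝ (⊤ : ℕ∞) f)
    (hfc : HasCompactSupport f) (Ω : Set (Euc n)) :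
    lpNormE (fun x => (‖gradient f x‖₊ : ℝ≥0∞)) n (volume.restrict Ω) ≠ ∞ := by
  have hg : Continuous (gradient f) :=
    (InnerProductSpace.toDual ℝ (Euc n)).symm.continuous.comp (hf.continuous_fderiv (by simp))
  have hgc : HasCompactSupport (gradient f) := (hfc.fderiv ℝ).comp_left (map_zero _)
  have hm : MemLp (gradient f) n (volume.restrict Ω) := hg.memLp_of_hasCompactSupport hgc
  rw [lpNormE, if_neg (ENNReal.natCast_ne_top n)]
  exact ENNReal.rpow_ne_top_of_nonneg (by positivity)
    (lintegral_rpow_enorm_lt_top_of_eLpNorm_lt_top (by simpa using hn)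
      (ENNReal.natCast_ne_top n) hm.2).ne

lemma HasWeakDerivOn.congr_ae {n : ℕ} {F : Euc n → Euc n} {G G' : Euc n → Euc n →L[ℝ] Euc n}
    (h : HasWeakDerivOn F G univ) (hG : G =ᵐ[volume] G') : HasWeakDerivOn F G' univ := by
  obtain ⟨h1, h2, h3⟩ := h
  refine ⟨h1, ?_, fun η hη hηc hηs v => ?_⟩
  · rw [locallyIntegrableOn_univ] at h2 ⊢
    exact h2.congr hG
  · rw [h3 η hη hηc hηs v, Measure.restrict_univ]
    congr 1
    refine integral_congr_ae ?_
    filter_upwards [hG] with x hx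
    rw [hx]

/-- Weak differentials of mappings which agree on an open set agree almost everywhere there. -/
lemma HasWeakDerivOn.ae_eq_of_eqOn {n : ℕ} {F F' : Euc n → Euc n}
    {G G' : Euc n → Euc n →L[ℝ] Euc n} (h : HasWeakDerivOn F G univ)
    (h' : HasWeakDerivOn F' G' univ) {U : Set (Euc n)} (hU : IsOpen U) (hF : EqOn F F' U) :
    ∀ᵐ x, x ∈ U → G x = G' x := by
  obtain ⟨-, hG, h⟩ := h
  obtain ⟨-, hG', h'⟩ := h'
  rw [locallyIntegrableOn_univ] at hG hG'
  have key := hU.ae_eq_zero_of_integral_contDiff_smul_eq_zero (μ := volume)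
    ((hG.sub hG').locallyIntegrableOn U) fun η hη hηc hηU => by
      have i1 : Integrable fun x => η x • G x :=
        hG.integrable_smul_left_of_hasCompactSupport hη.continuous hηc
      have i2 : Integrable fun x => η x • G' x :=
        hG'.integrable_smul_left_of_hasCompactSupport hη.continuous hηc
      simp only [Pi.sub_apply, smul_sub]
      rw [integral_sub i1 i2, sub_eq_zero]
      ext1 v
      rw [ContinuousLinearMap.integral_apply i1, ContinuousLinearMap.integral_apply i2]
      have e := h η hη hηc (subset_univ _) v
      have e' := h' η hη hηc (subset_univ _) v
      rw [Measure.restrict_univ] at e e'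
      refine neg_injective (e.symm.trans (Eq.trans ?_ e'))
      refine integral_congr_ae (Eventually.of_forall fun x => ?_)
      by_cases hx : x ∈ U
      · simp only [hF hx]
      · have : fderiv ℝ η x = 0 :=
          image_eq_zero_of_notMem_tsupport fun h => hx (hηU (tsupport_fderiv_subset ℝ h))
        simp [this]
  filter_upwards [key] with x hx hxU
  exact sub_eq_zero.1 (hx hxU)

lemma IsOpen.exists_monotone_compact_exhaustion {n : ℕ} {Ω : Set (Euc n)} (hΩ : IsOpen Ω) :
    ∃ K : ℕ → Set (Euc n), Monotone K ∧ (∀ m, IsCompact (K m)) ∧ (∀ m, K m ⊆ Ω) ∧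
      ⋃ m, interior (K m) = Ω := by
  have : LocallyCompactSpace Ω := hΩ.locallyCompactSpace
  set E : CompactExhaustion Ω := default
  refine ⟨fun m => Subtype.val '' E m, fun l m h => image_mono (E.subset h),
    fun m => (E.isCompact m).image continuous_subtype_val, fun m => Subtype.coe_image_subset _ _,
    Subset.antisymm (iUnion_subset fun m => interior_subset.trans (Subtype.coe_image_subset _ _))
      fun x hx => ?_⟩
  obtain ⟨m, hm⟩ := E.exists_mem ⟨x, hx⟩
  refine mem_iUnion.2 ⟨m + 1, hΩ.isOpenMap_subtype_val.image_interior_subset _ ?_⟩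
  exact ⟨_, E.subset_interior_succ m hm, rfl⟩

/-- The linear map with coordinate functionals `⟪a i, ·⟫`, depending linearly on `a`. -/
def clmOfRows (n : ℕ) : (Fin n → Euc n) →L[ℝ] Euc n →L[ℝ] Euc n :=
  LinearMap.toContinuousLinearMap
    { toFun := fun a => ∑ i, (innerSL ℝ (a i)).smulRight (EuclideanSpace.single i (1 : ℝ))
      map_add' := fun a b => by ext v i; simp [Pi.single_apply]
      map_smul' := fun c a => by ext v i; simp [Pi.single_apply] }

lemma clmOfRows_apply {n : ℕ} (a : Fin n → Euc n) (v : Euc n) (i : Fin n) :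
    clmOfRows n a v i = ⟪a i, v⟫ := by
  simp [clmOfRows, Pi.single_apply]

lemma LocallyIntegrableOn.clmOfRows {n : ℕ} {Ω : Set (Euc n)} {g : Fin n → Euc n → Euc n}
    (hg : ∀ i, LocallyIntegrableOn (g i) Ω) :
    LocallyIntegrableOn (fun x => clmOfRows n fun i => g i x) Ω := by
  intro x hx
  choose t ht hti using fun i => hg i x hx
  refine ⟨⋂ i, t i, Filter.iInter_mem.2 ht, ?_⟩
  have hI : Integrable (fun x i => g i x) (volume.restrict (⋂ i, t i)) :=
    Integrable.of_eval fun i => (hti i).mono_set (iInter_subset _ i)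
  exact (_root_.clmOfRows n).integrable_comp hI

/-- A mapping supported in a compact subset of `Ω` whose coordinates are weakly differentiable on
`Ω` is weakly differentiable on the whole space. -/
lemma exists_hasWeakDerivOn_univ {n : ℕ} {Ω L : Set (Euc n)} (hΩ : IsOpen Ω) (hL : IsCompact L)
    (hLΩ : L ⊆ Ω) {F : Euc n → Euc n} (hF : Continuous F) (hFL : ∀ x ∉ L, F x = 0)
    (hg : ∀ i, ∃ g, HasWeakGradientOn (fun x => F x i) g Ω) :
    ∃ G, StronglyMeasurable G ∧ HasWeakDerivOn F G univ := by
  choose g hg using hg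
  obtain ⟨χ, hχ, hχc, hχΩ, hχ1⟩ := exists_contDiff_cutoff hL hΩ hLΩ
  set G := fun x => χ x • clmOfRows n fun i => g i x with hGdef
  have hχ0 : ∀ x ∉ tsupport χ, χ x = 0 := fun x hx => image_eq_zero_of_notMem_tsupport hx
  have hG : Integrable G := by
    have h1 : IntegrableOn G (tsupport χ) :=
      ((LocallyIntegrableOn.clmOfRows fun i => (hg i).2.1).integrableOn_compact_subset hχΩ
        hχc).continuousOn_smul hχ.continuous.continuousOn hχc
    refine (integrableOn_iff_integrable_of_support_subset (f := G) ?_).1 h1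
    exact Function.support_subset_iff'.2 fun x hx => by
      simp only [hGdef, hχ0 x hx]
      exact zero_smul ℝ (clmOfRows n fun i => g i x)
  have hweak : HasWeakDerivOn F G univ := by
    refine ⟨hF.locallyIntegrable.locallyIntegrableOn _, hG.locallyIntegrable.locallyIntegrableOn _,
      fun η hη hηc _ v => ?_⟩
    simp only [Measure.restrict_univ]
    have hη' : Continuous fun x => fderiv ℝ η x v :=
      (hη.continuous_fderiv (by simp)).clm_apply continuous_const
    have i1 : Integrable fun x => fderiv ℝ η x v • F x :=
      (hη'.smul hF).integrable_of_hasCompactSupport (hηc.fderiv_apply ℝ v).smul_right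
    have i2 : Integrable fun x => η x • G x v :=
      ((hG.locallyIntegrable.integrable_smul_left_of_hasCompactSupport hη.continuous
        hηc).apply_continuousLinearMap v)
    have key : ∀ i, ∫ x, fderiv ℝ η x v * F x i = - ∫ x, η x * G x v i := by
      intro i
      have hχη : tsupport (fun x => χ x * η x) ⊆ Ω := (tsupport_mul_subset_left).trans hχΩ
      have h := (hg i).2.2 (fun x => χ x * η x) (hχ.mul hη) hηc.mul_left hχη v
      rw [setIntegral_eq_integral_of_forall_compl_eq_zero (fun x hx => by
          simp [hFL x fun h => hx (hLΩ h)]),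
        setIntegral_eq_integral_of_forall_compl_eq_zero (fun x hx => by
          simp [hχ0 x fun h => hx (hχΩ h)])] at h
      convert h using 1
      · refine integral_congr_ae (Eventually.of_forall fun x => ?_)
        by_cases hx : x ∈ L
        · have he : (fun x => χ x * η x) =ᶠ[nhds x] η := by
            filter_upwards [hχ1.filter_mono (nhds_le_nhdsSet hx)] with y hy
            rw [hy, one_mul]
          simp only [he.fderiv_eq, mul_comm]
        · simp [hFL x hx]
      · congr 1
        refine integral_congr_ae (Eventually.of_forall fun x => ?_)
        simp only [hGdef, smul_apply, PiLp.smul_apply, clmOfRows_apply, smul_eq_mul]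
        ring
    ext i
    have e1 := (EuclideanSpace.proj (𝕜 := ℝ) i).integral_comp_comm i1
    have e2 := (EuclideanSpace.proj (𝕜 := ℝ) i).integral_comp_comm i2
    simp only [PiLp.proj_apply, PiLp.smul_apply, smul_eq_mul] at e1 e2
    rw [PiLp.neg_apply, ← e1, ← e2, key]
  exact ⟨hG.1.mk G, hG.1.stronglyMeasurable_mk, hweak.congr_ae hG.1.ae_eq_mk⟩

/-- A homeomorphism which pulls back smooth compactly supported functions to weakly differentiable
ones coincides on every compact set with a continuous weakly differentiable mapping of the whole
space. -/
lemma IsHomeoOn.exists_hasWeakDerivOn_univ_eqOn {n : ℕ} {φ : Euc n → Euc n} {Ω Ω' : Set (Euc n)}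
    (hφ : IsHomeoOn φ Ω Ω') (hΩ : IsOpen Ω) (hΩ' : IsOpen Ω')
    (hcomp : ∀ f : Euc n → ℝ, ContDiff ℝ (⊤ : ℕ∞) f → HasCompactSupport f →
      ∃ g, HasWeakGradientOn (f ∘ φ) g Ω) {K : Set (Euc n)} (hK : IsCompact K) (hKΩ : K ⊆ Ω) :
    ∃ F G, Continuous F ∧ StronglyMeasurable G ∧ HasWeakDerivOn F G univ ∧ EqOn φ F K := by
  obtain ⟨χ, hχ, hχc, hχΩ, hχ1⟩ := exists_contDiff_cutoff
    (hK.image_of_continuousOn (hφ.2.1.mono hKΩ)) hΩ'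
    ((image_mono hKΩ).trans hφ.1.mapsTo.image_subset)
  have hL := hφ.isCompact_inter_preimage hχc hχΩ
  set F : Euc n → Euc n := fun x => if x ∈ Ω then χ (φ x) • φ x else 0 with hFdef
  have hFL : ∀ x ∉ Ω ∩ φ ⁻¹' tsupport χ, F x = 0 := by
    intro x hx
    by_cases hxΩ : x ∈ Ω
    · simp [hFdef, image_eq_zero_of_notMem_tsupport fun h => hx ⟨hxΩ, h⟩]
    · simp [hFdef, hxΩ]
  have hF : Continuous F := by
    refine continuous_iff_continuousAt.2 fun x => ?_
    by_cases hx : x ∈ Ω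
    · have h : ContinuousAt φ x := hφ.2.1.continuousAt (hΩ.mem_nhds hx)
      refine ((hχ.continuous.continuousAt.comp h).smul h).congr ?_
      filter_upwards [hΩ.mem_nhds hx] with y hy
      simp [hFdef, hy]
    · refine (continuousAt_const (y := 0)).congr ?_
      filter_upwards [hL.isClosed.isOpen_compl.mem_nhds fun h => hx h.1] with y hy
      exact (hFL y hy).symm
  obtain ⟨G, hGm, hG⟩ := exists_hasWeakDerivOn_univ hΩ hL inter_subset_left hF hFL fun i => by
    obtain ⟨g, h1, h2, h3⟩ := hcomp (fun y => χ y * y i)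
      (hχ.mul (EuclideanSpace.proj (𝕜 := ℝ) i).contDiff) hχc.mul_right
    refine ⟨g, ?_, h2, fun η hη hηc hηΩ v => ?_⟩
    · exact ((EuclideanSpace.proj (𝕜 := ℝ) i).continuous.comp
        hF).locallyIntegrable.locallyIntegrableOn _
    · rw [← h3 η hη hηc hηΩ v]
      refine setIntegral_congr_fun hΩ.measurableSet fun x hx => ?_
      simp [hFdef, hx]
  refine ⟨F, G, hF, hGm, hG, fun x hx => ?_⟩
  simp [hFdef, hKΩ hx, hχ1.self_of_nhdsSet _ (mem_image_of_mem φ hx)]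

/-- If `Ω` is a countable union of open sets on each of which `φ` agrees with a continuous weakly
differentiable mapping of the whole space, then `φ` is weakly differentiable on `Ω`, and almost all
of `Ω` is covered by countably many measurable sets relative to which the weak differential is a
classical one. -/
lemma exists_hasWeakDerivOn_hasFDerivWithinAt {n : ℕ} {φ : Euc n → Euc n} {Ω : Set (Euc n)}
    (hφ : ContinuousOn φ Ω) {U : ℕ → Set (Euc n)} (hU : ∀ m, IsOpen (U m)) (hUmono : Monotone U)
    (hUΩ : ⋃ m, U m = Ω) {F : ℕ → Euc n → Euc n} {G : ℕ → Euc n → Euc n →L[ℝ] Euc n}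
    (hF : ∀ m, Continuous (F m)) (hGm : ∀ m, StronglyMeasurable (G m))
    (hFG : ∀ m, HasWeakDerivOn (F m) (G m) univ) (hφF : ∀ m, EqOn φ (F m) (U m)) :
    ∃ (D : Euc n → Euc n →L[ℝ] Euc n) (s : ℕ → Set (Euc n)), Measurable D ∧
      HasWeakDerivOn φ D Ω ∧ (∀ k, MeasurableSet (s k)) ∧ (∀ k, s k ⊆ Ω) ∧
      (∀ k, ∀ x ∈ s k, HasFDerivWithinAt φ (D x) (s k) x) ∧ volume (Ω \ ⋃ k, s k) = 0 := by
  have hΩ : IsOpen Ω := hUΩ ▸ isOpen_iUnion hU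
  have hUsub : ∀ m, U m ⊆ Ω := fun m => hUΩ ▸ subset_iUnion U m
  have hex : ∀ x, ∃ m, x ∈ U m ∨ x ∉ Ω := fun x => by
    by_cases hx : x ∈ Ω
    · obtain ⟨m, hm⟩ := mem_iUnion.1 (hUΩ.symm ▸ hx)
      exact ⟨m, Or.inl hm⟩
    · exact ⟨0, Or.inr hx⟩
  set D : Euc n → Euc n →L[ℝ] Euc n := fun x => G (Nat.find (hex x)) x with hD
  have hDm : Measurable D := Measurable.find
    (p := fun m x => x ∈ U m ∨ x ∉ Ω) (fun m => (hGm m).measurable)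
    (fun m => (hU m).measurableSet.union hΩ.measurableSet.compl) hex
  have hDG : ∀ m, ∀ᵐ x, x ∈ U m → D x = G m x := by
    intro m
    have h : ∀ l, ∀ᵐ x, x ∈ U l ∩ U m → G l x = G m x := fun l =>
      (hFG l).ae_eq_of_eqOn (hFG m) ((hU l).inter (hU m)) fun x hx =>
        (hφF l hx.1).symm.trans (hφF m hx.2)
    filter_upwards [ae_all_iff.2 h] with x hx hxm
    exact hx _ ⟨(Nat.find_spec (hex x)).resolve_right (not_not.2 (hUsub m hxm)), hxm⟩
  have hweak : HasWeakDerivOn φ D Ω := by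
    refine ⟨hφ.locallyIntegrableOn hΩ.measurableSet, fun x hx => ?_, fun η hη hηc hηΩ v => ?_⟩
    · obtain ⟨m, hm⟩ := mem_iUnion.1 (hUΩ.symm ▸ hx)
      have hG := (hFG m).2.1
      rw [locallyIntegrableOn_univ] at hG
      obtain ⟨t, ht, hti⟩ := hG x
      obtain ⟨B, hBt, hB, hxB⟩ := mem_nhds_iff.1 (inter_mem ht ((hU m).mem_nhds hm))
      refine ⟨B, mem_nhdsWithin_of_mem_nhds (hB.mem_nhds hxB), ?_⟩
      refine Integrable.congr (hti.mono_set (hBt.trans inter_subset_left)) ?_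
      refine (ae_restrict_iff' hB.measurableSet).2 ?_
      filter_upwards [hDG m] with y hy hyB
      exact (hy (hBt hyB).2).symm
    · obtain ⟨m, hm⟩ := hηc.isCompact.elim_directed_cover U hU (hUΩ.symm ▸ hηΩ)
        hUmono.directed_le
      have h := (hFG m).2.2 η hη hηc (subset_univ _) v
      have hη0 : ∀ x ∉ U m, η x = 0 := fun x hx =>
        image_eq_zero_of_notMem_tsupport fun h => hx (hm h)
      have hη1 : ∀ x ∉ U m, fderiv ℝ η x = 0 := fun x hx =>
        image_eq_zero_of_notMem_tsupport fun h => hx (hm (tsupport_fderiv_subset ℝ h))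
      rw [Measure.restrict_univ] at h
      rw [setIntegral_eq_integral_of_forall_compl_eq_zero
          (fun x hx => by simp [hη1 x fun h => hx (hUsub m h)]),
        setIntegral_eq_integral_of_forall_compl_eq_zero
          (fun x hx => by simp [hη0 x fun h => hx (hUsub m h)])]
      convert h using 1
      · refine integral_congr_ae (Eventually.of_forall fun x => ?_)
        by_cases hx : x ∈ U m
        · simp only [hφF m hx]
        · simp [hη1 x hx]
      · congr 1
        refine integral_congr_ae ?_
        filter_upwards [hDG m] with x hx
        by_cases hxm : x ∈ U m
        · rw [hx hxm]
        · simp [hη0 x hxm]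
  choose E hEm hE0 hEd using fun m =>
    HasWeakDerivOn.exists_hasFDerivWithinAt (hF m) (hGm m) (hFG m)
  set N : ℕ → Set (Euc n) := fun m => toMeasurable volume {x | ¬(x ∈ U m → D x = G m x)} with hN
  have hN0 : ∀ m, volume (N m) = 0 := fun m => (measure_toMeasurable _).trans (hDG m)
  set s : ℕ → Set (Euc n) := fun k =>
    (E (Nat.unpair k).1 (Nat.unpair k).2 ∩ U (Nat.unpair k).1) \ N (Nat.unpair k).1 with hs
  refine ⟨D, s, hDm, hweak, fun k => ?_, fun k => ?_, fun k x hx => ?_, ?_⟩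
  · exact ((hEm _ _).inter (hU _).measurableSet).diff (measurableSet_toMeasurable _ _)
  · exact sdiff_subset.trans (inter_subset_right.trans (hUsub _))
  · obtain ⟨⟨hxE, hxU⟩, hxN⟩ := hx
    have hDx : D x = G (Nat.unpair k).1 x := by
      by_contra hne
      exact hxN (subset_toMeasurable _ _ fun h => hne (h hxU))
    rw [hDx]
    exact ((hEd _ _ x hxE).mono (sdiff_subset.trans inter_subset_left)).congr
      (fun y hy => hφF _ hy.1.2) (hφF _ hxU)
  · refine measure_mono_null (t := ⋃ m, ((⋃ k, E m k)ᶜ ∪ N m)) ?_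
      (measure_iUnion_null fun m => measure_union_null (hE0 m) (hN0 m))
    rintro x ⟨hxΩ, hxs⟩
    obtain ⟨m, hm⟩ := mem_iUnion.1 (hUΩ.symm ▸ hxΩ)
    refine mem_iUnion.2 ⟨m, ?_⟩
    by_contra hcon
    rw [mem_union, not_or, notMem_compl_iff] at hcon
    obtain ⟨j, hj⟩ := mem_iUnion.1 hcon.1
    exact hxs (mem_iUnion.2 ⟨Nat.pair m j, by simpa [hs] using ⟨⟨hj, hm⟩, hcon.2⟩⟩)
theorem statement_8 (n : ℕ) (hn : 2 ≤ n) (Ω Ω' : Set (Euc n))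
    (hΩ : IsDomainIn Ω) (hΩ' : IsDomainIn Ω')
    (q : ℝ) (hq : 1 ≤ q) (hqn : q < n)
    (φ : Euc n → Euc n) (hφ : IsHomeoOn φ Ω Ω')
    (hcomp : IsCompOpBdd Ω Ω' φ (n : ℝ≥0∞) (ENNReal.ofReal q)) :
    ∃ (D : Euc n → Euc n →L[ℝ] Euc n) (S : Set (Euc n)) (C : ℝ≥0∞),
      HasWeakDerivOn φ D Ω ∧ volume S = 0 ∧ C ≠ ∞ ∧
      ∀ᵐ y ∂(volume.restrict Ω'),
        volDerivInv φ Ω y ≤ C * distortionH D φ Ω S q y ^ ((n : ℝ) * q / ((n : ℝ) - q)) := by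
  have hn0 : NeZero n := ⟨by lia⟩
  obtain ⟨K₀, -, hcomp⟩ := hcomp
  obtain ⟨K, hKmono, hK, hKΩ, hKU⟩ := hΩ.1.exists_monotone_compact_exhaustion
  choose F G hF hGm hFG hφF using fun m =>
    hφ.exists_hasWeakDerivOn_univ_eqOn hΩ.1 hΩ'.1
      (fun f hf hfc => (hcomp f _ (hf.hasWeakGradientOn Ω')
        (lpNormE_gradient_ne_top hn0.ne hf hfc Ω')).imp fun _ h => h.1) (hK m) (hKΩ m)
  obtain ⟨D, s, hDm, hD, hsm, hsΩ, hd, hS⟩ := exists_hasWeakDerivOn_hasFDerivWithinAt hφ.2.1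
    (fun m => isOpen_interior) (fun l m h => interior_mono (hKmono h)) hKU hF hGm hFG
    fun m => (hφF m).mono interior_subset
  refine ⟨D, Ω \ ⋃ k, s k, 1, hD, hS, ENNReal.one_ne_top, ?_⟩
  filter_upwards [hφ.volDerivInv_le_invJacobianInv hΩ.1 hΩ'.1 hDm hsm hsΩ hd hS] with y hy
  rw [one_mul]
  exact hy.trans (invJacobianInv_le_distortionH hq hqn D φ Ω _ y)
end
end

section
/- Let Ω ⊂ ℝ² and f ∈ W¹₁(Ω). Then for any r > 0 and any z₀ ∈ Ω such that dist(z₀, ∂Ω) > 2r, the inequality (∬_{D(z₀,r)} |f(z) − f_{D(z₀,r)}|² dxdy)^{1/2} ≤ (3√(π³)/4) ∬_{D(z₀,r)} |∇f(z)| dxdy holds, where f_{D(z₀,r)} is the mean value of f over the disk D(z₀,r). -/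
open MeasureTheory ENNReal Set Filter
open scoped RealInnerProductSpace

noncomputable section

attribute [local instance] Classical.propDecidable

open Function in
/-- A Gagliardo–Nirenberg type argument in polar coordinates: an abstract `L¹`-`L²` Poincaré
inequality for a function of `(ρ, θ)` whose radial and tangential oscillations are controlled
by the integrals of `p`. -/
theorem exists_lintegral_sq_le_of_polar {G : ℝ → ℝ → ℝ} {p : ℝ → ℝ → ℝ≥0∞}
    (hG : Measurable (uncurry G)) (hp : Measurable (uncurry p)) {r : ℝ}
    (hrad : ∀ θ, ∀ ρ ∈ Ioo 0 r, ‖G ρ θ - G r θ‖ₑ ≤ ∫⁻ s in Ioo ρ r, p s θ)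
    (htan : ∀ ρ ∈ Ioo 0 r, ∀ θ ∈ Ioo (-Real.pi) Real.pi, ∀ φ ∈ Ioo (-Real.pi) Real.pi,
      ‖G ρ θ - G ρ φ‖ₑ ≤ ∫⁻ ψ in Ioo (-Real.pi) Real.pi, ENNReal.ofReal ρ * p ρ ψ) :
    ∃ c : ℝ, ∫⁻ ρ in Ioo 0 r, ∫⁻ θ in Ioo (-Real.pi) Real.pi,
        ENNReal.ofReal ρ * ‖G ρ θ - c‖ₑ ^ 2 ≤
      ENNReal.ofReal (9 * Real.pi ^ 3 / 16) *
        (∫⁻ ρ in Ioo 0 r, ∫⁻ θ in Ioo (-Real.pi) Real.pi, ENNReal.ofReal ρ * p ρ θ) ^ 2 := by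
  have hpi := Real.pi_gt_d2
  set S : Set ℝ := Ioo 0 r
  set Θ : Set ℝ := Ioo (-Real.pi) Real.pi
  set T := ∫⁻ ρ in S, ∫⁻ θ in Θ, ENNReal.ofReal ρ * p ρ θ
  have hpm : Measurable (fun x : ℝ × ℝ => ENNReal.ofReal x.1 * p x.1 x.2) := by
    have : Measurable (fun x : ℝ × ℝ => p x.1 x.2) := hp
    fun_prop
  have hpθ : ∀ θ, Measurable (fun s => p s θ) := fun θ =>
    hp.comp (measurable_id.prodMk measurable_const)
  have hGθ : ∀ θ, Measurable (fun s => G s θ) := fun θ =>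
    hG.comp (measurable_id.prodMk measurable_const)
  let A : ℝ → ℝ≥0∞ := fun θ => ∫⁻ s in S, ENNReal.ofReal s * p s θ
  let B : ℝ → ℝ≥0∞ := fun ρ => ∫⁻ θ in Θ, ENNReal.ofReal ρ * p ρ θ
  have hAm : Measurable A := Measurable.lintegral_prod_left' hpm
  have hBm : Measurable B := Measurable.lintegral_prod_right' hpm
  have hAT : ∫⁻ θ in Θ, A θ = T := lintegral_lintegral_swap (hpm.comp measurable_swap).aemeasurable
  have hΘ : volume Θ = ENNReal.ofReal (2 * Real.pi) := by
    simp only [Θ, Real.volume_Ioo]; congr 1; ring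
  have hS : volume S = ENNReal.ofReal r := by simp [S]
  -- integrated and pointwise radial bounds
  have htri : ∀ θ, ∫⁻ ρ in S, ‖G ρ θ - G r θ‖ₑ ≤ A θ := by
    intro θ
    calc ∫⁻ ρ in S, ‖G ρ θ - G r θ‖ₑ ≤ ∫⁻ ρ in S, ∫⁻ s in S, (Ioi ρ).indicator (fun s => p s θ) s := by
          refine setLIntegral_mono' measurableSet_Ioo fun ρ hρ => (hrad θ ρ hρ).trans ?_
          rw [← lintegral_indicator measurableSet_Ioo, ← lintegral_indicator measurableSet_Ioo]
          refine lintegral_mono fun s => ?_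
          by_cases h : s ∈ Ioo ρ r
          · have h1 : s ∈ S := ⟨hρ.1.trans h.1, h.2⟩
            have h2 : s ∈ Ioi ρ := h.1
            rw [indicator_of_mem h, indicator_of_mem h1, indicator_of_mem h2]
          · simp [h]
      _ = ∫⁻ s in S, ∫⁻ ρ in S, (Ioi ρ).indicator (fun s => p s θ) s := by
          refine lintegral_lintegral_swap (Measurable.aemeasurable ?_)
          have : Measurable (fun x : ℝ × ℝ => ({x : ℝ × ℝ | x.1 < x.2}).indicator
              (fun x => p x.2 θ) x) :=
            ((hpθ θ).comp measurable_snd).indicator (measurableSet_lt measurable_fst measurable_snd)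
          exact this
      _ ≤ A θ := by
          refine setLIntegral_mono' measurableSet_Ioo fun s hs => ?_
          calc ∫⁻ ρ in S, (Ioi ρ).indicator (fun s => p s θ) s
              ≤ ∫⁻ ρ in S, (Iio s).indicator (fun _ => p s θ) ρ := by
                refine lintegral_mono fun ρ => ?_
                by_cases h : ρ < s <;> simp [h]
            _ = p s θ * volume (Iio s ∩ S) := by
                rw [lintegral_indicator_const measurableSet_Iio,
                  Measure.restrict_apply measurableSet_Iio]
            _ ≤ p s θ * volume (Ioo 0 s) := by
                gcongr
                exact fun x hx => ⟨hx.2.1, hx.1⟩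
            _ = _ := by simp [mul_comm]
  have hpt : ∀ θ, ∀ ρ ∈ S, ENNReal.ofReal ρ * ‖G ρ θ - G r θ‖ₑ ≤ A θ := by
    intro θ ρ hρ
    calc ENNReal.ofReal ρ * ‖G ρ θ - G r θ‖ₑ ≤ ENNReal.ofReal ρ * ∫⁻ s in Ioo ρ r, p s θ := by
          gcongr; exact hrad θ ρ hρ
      _ = ∫⁻ s in Ioo ρ r, ENNReal.ofReal ρ * p s θ := (lintegral_const_mul _ (hpθ θ)).symm
      _ ≤ ∫⁻ s in Ioo ρ r, ENNReal.ofReal s * p s θ := by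
          refine setLIntegral_mono' measurableSet_Ioo fun s hs => ?_
          gcongr; exact hs.1.le
      _ ≤ A θ := lintegral_mono_set (Ioo_subset_Ioo_left hρ.1.le)
  obtain ⟨φ, hφ, hAφ⟩ : ∃ φ ∈ Θ, A φ ≤ ENNReal.ofReal (1 / (2 * Real.pi)) * T := by
    obtain ⟨φ, hφ, h⟩ := exists_le_setLAverage (μ := volume) (s := Θ) (f := A)
      (by rw [hΘ]; simp; positivity) (by rw [hΘ]; exact ofReal_ne_top) hAm.aemeasurable
    refine ⟨φ, hφ, h.trans ?_⟩
    rw [setLAverage_eq, hAT, hΘ, one_div, ENNReal.ofReal_inv_of_pos (by positivity),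
      ENNReal.div_eq_inv_mul]
  set a : ℝ := 1 / (2 * Real.pi)
  have ha : 0 ≤ a := by positivity
  have hTa : T + ENNReal.ofReal a * T = ENNReal.ofReal (1 + a) * T := by
    rw [ENNReal.ofReal_add zero_le_one ha, ENNReal.ofReal_one, add_mul, one_mul]
  let β : ℝ → ℝ≥0∞ := fun ρ => B ρ + ‖G ρ φ - G r φ‖ₑ
  have hβm : Measurable β := hBm.add ((hGθ φ).sub_const _).enorm
  have hβ : ∫⁻ ρ in S, β ρ ≤ ENNReal.ofReal (1 + a) * T := by
    rw [← hTa, lintegral_add_left hBm]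
    gcongr
    exact (htri φ).trans hAφ
  have hGβ : ∀ ρ ∈ S, ∀ θ ∈ Θ, ‖G ρ θ - G r φ‖ₑ ≤ β ρ := fun ρ hρ θ hθ =>
    calc ‖G ρ θ - G r φ‖ₑ = ‖(G ρ θ - G ρ φ) + (G ρ φ - G r φ)‖ₑ := by congr 1; ring
      _ ≤ _ := (enorm_add_le _ _).trans (add_le_add_left (htan ρ hρ θ hθ φ hφ) _)
  have hbdry : ∀ θ ∈ Θ, ENNReal.ofReal r * ‖G r θ - G r φ‖ₑ ≤ A θ + ENNReal.ofReal (1 + a) * T := by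
    intro θ hθ
    calc ENNReal.ofReal r * ‖G r θ - G r φ‖ₑ = ∫⁻ ρ in S, ‖G r θ - G r φ‖ₑ := by
          simp [hS, mul_comm]
      _ ≤ ∫⁻ ρ in S, (‖G ρ θ - G r θ‖ₑ + β ρ) := by
          refine setLIntegral_mono' measurableSet_Ioo fun ρ hρ => ?_
          calc ‖G r θ - G r φ‖ₑ = ‖-(G ρ θ - G r θ) + (G ρ θ - G r φ)‖ₑ := by congr 1; ring
            _ ≤ ‖G ρ θ - G r θ‖ₑ + ‖G ρ θ - G r φ‖ₑ := by
              rw [← enorm_neg (G ρ θ - G r θ)]; exact enorm_add_le _ _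
            _ ≤ _ := by gcongr; exact hGβ ρ hρ θ hθ
      _ = (∫⁻ ρ in S, ‖G ρ θ - G r θ‖ₑ) + ∫⁻ ρ in S, β ρ := lintegral_add_right _ hβm
      _ ≤ _ := add_le_add (htri θ) hβ
  let α : ℝ → ℝ≥0∞ := fun θ => A θ + (A θ + ENNReal.ofReal (1 + a) * T)
  have hαm : Measurable α := hAm.add (hAm.add_const _)
  have hGα : ∀ ρ ∈ S, ∀ θ ∈ Θ, ENNReal.ofReal ρ * ‖G ρ θ - G r φ‖ₑ ≤ α θ := fun ρ hρ θ hθ =>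
    calc ENNReal.ofReal ρ * ‖G ρ θ - G r φ‖ₑ
        = ENNReal.ofReal ρ * ‖(G ρ θ - G r θ) + (G r θ - G r φ)‖ₑ := by congr 2; ring
      _ ≤ ENNReal.ofReal ρ * ‖G ρ θ - G r θ‖ₑ + ENNReal.ofReal ρ * ‖G r θ - G r φ‖ₑ := by
          rw [← mul_add]; gcongr; exact enorm_add_le _ _
      _ ≤ ENNReal.ofReal ρ * ‖G ρ θ - G r θ‖ₑ + ENNReal.ofReal r * ‖G r θ - G r φ‖ₑ := by
          gcongr; exact hρ.2.le
      _ ≤ α θ := add_le_add (hpt θ ρ hρ) (hbdry θ hθ)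
  have hα : ∫⁻ θ in Θ, α θ = ENNReal.ofReal (3 + 2 * Real.pi) * T := by
    have h1 : 3 + 2 * Real.pi = 1 + (1 + (1 + a) * (2 * Real.pi)) := by
      simp only [a]; field_simp; ring
    have h2 : ENNReal.ofReal (3 + 2 * Real.pi) =
        1 + (1 + ENNReal.ofReal (1 + a) * ENNReal.ofReal (2 * Real.pi)) := by
      rw [h1, ENNReal.ofReal_add (by positivity) (by positivity),
        ENNReal.ofReal_add (by positivity) (by positivity), ENNReal.ofReal_mul (by positivity),
        ENNReal.ofReal_one]
    rw [lintegral_add_left hAm, lintegral_add_left hAm, hAT, setLIntegral_const, hΘ, h2]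
    ring
  refine ⟨G r φ, ?_⟩
  calc ∫⁻ ρ in S, ∫⁻ θ in Θ, ENNReal.ofReal ρ * ‖G ρ θ - G r φ‖ₑ ^ 2
      ≤ ∫⁻ ρ in S, ∫⁻ θ in Θ, β ρ * α θ := by
        refine setLIntegral_mono' measurableSet_Ioo fun ρ hρ =>
          setLIntegral_mono' measurableSet_Ioo fun θ hθ => ?_
        calc ENNReal.ofReal ρ * ‖G ρ θ - G r φ‖ₑ ^ 2
            = ‖G ρ θ - G r φ‖ₑ * (ENNReal.ofReal ρ * ‖G ρ θ - G r φ‖ₑ) := by ring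
          _ ≤ _ := mul_le_mul' (hGβ ρ hρ θ hθ) (hGα ρ hρ θ hθ)
    _ = (∫⁻ ρ in S, β ρ) * ∫⁻ θ in Θ, α θ := by
        simp_rw [lintegral_const_mul _ hαm]
        rw [lintegral_mul_const _ hβm]
    _ ≤ (ENNReal.ofReal (1 + a) * T) * (ENNReal.ofReal (3 + 2 * Real.pi) * T) := by
        rw [hα]; gcongr
    _ = ENNReal.ofReal ((1 + a) * (3 + 2 * Real.pi)) * T ^ 2 := by
        rw [ENNReal.ofReal_mul (by positivity)]; ring
    _ ≤ _ := by
        gcongr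
        have h1 : (1 + a) * (3 + 2 * Real.pi) = 4 + 2 * Real.pi + 3 * a := by
          simp only [a]; field_simp; ring
        have h2 : a ≤ 1 / 6 := by
          simp only [a]; gcongr; linarith
        have h3 : (3.14 : ℝ) ^ 2 ≤ Real.pi ^ 2 := by gcongr
        nlinarith

/-- `L¹`-`L²` Poincaré inequality on disks for `C¹` functions. -/
theorem exists_lintegral_ball_sq_le_complex {f : ℂ → ℝ} (hf : ContDiff ℝ 1 f) (r : ℝ) :
    ∃ c : ℝ, ∫⁻ z in Metric.ball (0 : ℂ) r, ‖f z - c‖ₑ ^ 2 ≤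
      ENNReal.ofReal (9 * Real.pi ^ 3 / 16) *
        (∫⁻ z in Metric.ball (0 : ℂ) r, ‖fderiv ℝ f z‖ₑ) ^ 2 := by
  let P : ℝ → ℝ → ℂ := fun ρ θ => ρ * (Real.cos θ + Real.sin θ * Complex.I)
  have hPeq : ∀ ρ θ, Complex.polarCoord.symm (ρ, θ) = P ρ θ := fun ρ θ => by
    simp [P, Complex.polarCoord_symm_apply]
  have hdir : ∀ θ : ℝ, ‖(Real.cos θ + Real.sin θ * Complex.I : ℂ)‖ₑ = 1 := fun θ => by
    rw [← ofReal_norm]; simp [Complex.norm_cos_add_sin_mul_I]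
  have hPc : Continuous (fun x : ℝ × ℝ => P x.1 x.2) := by fun_prop
  have hpolar : ∀ h : ℂ → ℝ≥0∞, Measurable h → ∫⁻ z in Metric.ball (0 : ℂ) r, h z =
      ∫⁻ ρ in Ioo 0 r, ∫⁻ θ in Ioo (-Real.pi) Real.pi, ENNReal.ofReal ρ * h (P ρ θ) := by
    intro h hh
    have hm : Measurable (fun x : ℝ × ℝ => ENNReal.ofReal x.1 * h (P x.1 x.2)) := by fun_prop
    rw [← lintegral_indicator Metric.isOpen_ball.measurableSet,
      ← Complex.lintegral_comp_polarCoord_symm, ← lintegral_prod _ hm.aemeasurable,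
      Measure.prod_restrict, ← Measure.volume_eq_prod,
      ← lintegral_indicator (measurableSet_Ioo.prod measurableSet_Ioo),
      ← lintegral_indicator polarCoord.open_target.measurableSet]
    refine lintegral_congr fun ⟨ρ, θ⟩ => ?_
    simp only [indicator, polarCoord_target, mem_prod, mem_Ioi, mem_Ioo, hPeq,
      mem_ball_zero_iff, smul_eq_mul]
    by_cases h0 : 0 < ρ
    · have : ‖P ρ θ‖ = ρ := by simp [P, Complex.norm_cos_add_sin_mul_I, abs_of_pos h0]
      rw [this]
      split_ifs <;> simp_all
    · simp [h0]
  have hfd : Measurable (fun z => ‖fderiv ℝ f z‖ₑ) := (hf.continuous_fderiv one_ne_zero).measurable.enorm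
  suffices h : ∃ c : ℝ, ∫⁻ ρ in Ioo 0 r, ∫⁻ θ in Ioo (-Real.pi) Real.pi,
      ENNReal.ofReal ρ * ‖f (P ρ θ) - c‖ₑ ^ 2 ≤ ENNReal.ofReal (9 * Real.pi ^ 3 / 16) *
        (∫⁻ ρ in Ioo 0 r, ∫⁻ θ in Ioo (-Real.pi) Real.pi,
          ENNReal.ofReal ρ * ‖fderiv ℝ f (P ρ θ)‖ₑ) ^ 2 by
    refine h.imp fun c hc => ?_
    rw [hpolar _ hfd, hpolar _ (by have := hf.continuous.measurable; fun_prop)]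
    exact hc
  refine exists_lintegral_sq_le_of_polar (G := fun ρ θ => f (P ρ θ))
    (p := fun ρ θ => ‖fderiv ℝ f (P ρ θ)‖ₑ) (hf.continuous.comp hPc).measurable
    (hfd.comp hPc.measurable) ?_ ?_
  · intro θ ρ hρ
    have hd : ∀ s, HasDerivAt (fun s : ℝ => P s θ) (Real.cos θ + Real.sin θ * Complex.I) s := fun s => by
      simpa [P] using (Complex.ofRealCLM.hasDerivAt (x := s)).mul_const
        (Real.cos θ + Real.sin θ * Complex.I : ℂ)
    have hder : ∀ s, deriv (fun s => f (P s θ)) s =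
        fderiv ℝ f (P s θ) (Real.cos θ + Real.sin θ * Complex.I) := fun s =>
      ((hf.differentiable one_ne_zero _).hasFDerivAt.comp_hasDerivAt s (hd s)).deriv
    have hcd : ContDiff ℝ 1 (fun s => f (P s θ)) :=
      hf.comp ((Complex.ofRealCLM.contDiff).mul contDiff_const)
    rw [enorm_sub_rev]
    refine (enorm_sub_le_lintegral_deriv_of_contDiffOn_Icc hcd.contDiffOn hρ.2.le).trans ?_
    rw [restrict_Ioo_eq_restrict_Icc]
    refine lintegral_mono fun s => ?_
    rw [hder]
    exact (ContinuousLinearMap.le_opENorm _ _).trans_eq (by rw [hdir, mul_one])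
  · intro ρ hρ
    have key : ∀ θ ∈ Ioo (-Real.pi) Real.pi, ∀ φ ∈ Ioo (-Real.pi) Real.pi, θ ≤ φ →
        ‖f (P ρ φ) - f (P ρ θ)‖ₑ ≤ ∫⁻ ψ in Ioo (-Real.pi) Real.pi,
          ENNReal.ofReal ρ * ‖fderiv ℝ f (P ρ ψ)‖ₑ := by
      intro θ hθ φ hφ hle
      have hd : ∀ s, HasDerivAt (fun s : ℝ => P ρ s)
          (ρ * ((Real.cos s + Real.sin s * Complex.I) * Complex.I)) s := fun s => by
        have h1 := (Real.hasDerivAt_cos s).ofReal_comp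
        have h2 := (Real.hasDerivAt_sin s).ofReal_comp.mul_const Complex.I
        refine ((h1.add h2).const_mul (ρ : ℂ)).congr_deriv ?_
        push_cast
        linear_combination (-ρ * Complex.sin s) * Complex.I_sq
      have hder : ∀ s, deriv (fun s => f (P ρ s)) s =
          fderiv ℝ f (P ρ s) (ρ * ((Real.cos s + Real.sin s * Complex.I) * Complex.I)) := fun s =>
        ((hf.differentiable one_ne_zero _).hasFDerivAt.comp_hasDerivAt s (hd s)).deriv
      have hcd : ContDiff ℝ 1 (fun s => f (P ρ s)) := by
        refine hf.comp (contDiff_const.mul (ContDiff.add ?_ (ContDiff.mul ?_ contDiff_const)))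
        · exact Complex.ofRealCLM.contDiff.comp Real.contDiff_cos
        · exact Complex.ofRealCLM.contDiff.comp Real.contDiff_sin
      refine (enorm_sub_le_lintegral_deriv_of_contDiffOn_Icc hcd.contDiffOn hle).trans ?_
      refine (lintegral_mono fun s => ?_).trans
        (lintegral_mono_set (Icc_subset_Ioo hθ.1 hφ.2))
      rw [hder]
      refine (ContinuousLinearMap.le_opENorm _ _).trans_eq ?_
      rw [enorm_mul, enorm_mul, hdir, mul_comm]
      simp [← ofReal_norm, abs_of_pos hρ.1]
    intro θ hθ φ hφ
    rcases le_total θ φ with h | h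
    · rw [enorm_sub_rev]; exact key θ hθ φ hφ h
    · exact key φ hφ θ hθ h

theorem exists_lintegral_ball_sq_le {f : Euc 2 → ℝ} (hf : ContDiff ℝ 1 f) (r : ℝ)
    (z₀ : Euc 2) :
    ∃ c : ℝ, ∫⁻ z in Metric.ball z₀ r, ‖f z - c‖ₑ ^ 2 ≤
      ENNReal.ofReal (9 * Real.pi ^ 3 / 16) *
        (∫⁻ z in Metric.ball z₀ r, ‖fderiv ℝ f z‖ₑ) ^ 2 := by
  let L : ℂ ≃ₗᵢ[ℝ] Euc 2 := Complex.orthonormalBasisOneI.repr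
  have hmp : MeasurePreserving (fun z => z₀ + L z) :=
    (measurePreserving_add_left volume z₀).comp L.measurePreserving
  have hemb : MeasurableEmbedding (fun z => z₀ + L z) :=
    (measurableEmbedding_addLeft z₀).comp L.toHomeomorph.measurableEmbedding
  have hball : (fun z => z₀ + L z) ⁻¹' Metric.ball z₀ r = Metric.ball 0 r := by
    ext z; simp [dist_eq_norm]
  have hcomp : ContDiff ℝ 1 (fun z => f (z₀ + L z)) :=
    hf.comp (contDiff_const.add L.contDiff)
  obtain ⟨c, hc⟩ := exists_lintegral_ball_sq_le_complex hcomp r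
  refine ⟨c, ?_⟩
  rw [← hmp.setLIntegral_comp_preimage_emb hemb, ← hmp.setLIntegral_comp_preimage_emb hemb, hball]
  refine hc.trans ?_
  gcongr with z
  have h1 : fderiv ℝ (fun z => f (z₀ + L z)) z =
      (fderiv ℝ f (z₀ + L z)).comp (L.toContinuousLinearEquiv : ℂ →L[ℝ] Euc 2) :=
    ((hf.differentiable one_ne_zero _).hasFDerivAt.comp z
      (L.toContinuousLinearEquiv.hasFDerivAt.const_add z₀)).fderiv
  rw [h1, ← ofReal_norm, ← ofReal_norm]
  refine ENNReal.ofReal_le_ofReal (ContinuousLinearMap.opNorm_le_bound _ (norm_nonneg _) fun v => ?_)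
  exact ((fderiv ℝ f (z₀ + L z)).le_opNorm (L v)).trans_eq (by rw [L.norm_map])

open scoped Convolution Topology

/-- The derivative of a mollification is controlled by the mollified weak gradient. -/
theorem enorm_fderiv_convolution_le {n : ℕ} {Ω : Set (Euc n)} {f : Euc n → ℝ} {g : Euc n → Euc n}
    (hfg : HasWeakGradientOn f g Ω) (hΩ : MeasurableSet Ω) (hfi : IntegrableOn f Ω)
    (φ : ContDiffBump (0 : Euc n)) {x : Euc n} (hx : Metric.closedBall x φ.rOut ⊆ Ω) :
    ‖fderiv ℝ (φ.normed volume ⋆[ContinuousLinearMap.lsmul ℝ ℝ, volume] Ω.indicator f) x‖ₑ ≤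
      ∫⁻ y in Ω, ‖g y‖ₑ * ENNReal.ofReal (φ.normed volume (x - y)) := by
  set ψ := φ.normed (volume : Measure (Euc n))
  have hψ : ContDiff ℝ (⊤ : ℕ∞) ψ := φ.contDiff_normed
  have hψ1 : ContDiff ℝ 1 ψ := φ.contDiff_normed
  have hψc : HasCompactSupport ψ := φ.hasCompactSupport_normed
  have hF : LocallyIntegrable (Ω.indicator f) :=
    ((integrable_indicator_iff hΩ).2 hfi).locallyIntegrable
  set M := ∫⁻ y in Ω, ‖g y‖ₑ * ENNReal.ofReal (ψ (x - y))
  rcases eq_or_ne M ∞ with hM | hM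
  · rw [hM]; exact le_top
  rw [← ENNReal.ofReal_toReal hM, ← ofReal_norm]
  refine ENNReal.ofReal_le_ofReal (ContinuousLinearMap.opNorm_le_bound _ toReal_nonneg fun v => ?_)
  let η : Euc n → ℝ := fun t => ψ (x - t)
  have hη : ContDiff ℝ (⊤ : ℕ∞) η := hψ.comp (contDiff_const.sub contDiff_id)
  have hηc : HasCompactSupport η := hψc.comp_homeomorph (Homeomorph.subLeft x)
  have hηΩ : tsupport η ⊆ Ω := by
    refine (closure_minimal (fun t ht => ?_) Metric.isClosed_closedBall).trans hx
    have h1 : x - t ∈ Function.support ψ := ht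
    rw [φ.support_normed_eq, mem_ball_zero_iff] at h1
    rw [Metric.mem_closedBall, dist_comm, dist_eq_norm]
    exact h1.le
  have hηd : ∀ t, fderiv ℝ η t v = - fderiv ℝ ψ (x - t) v := fun t => by
    have h1 : HasFDerivAt η ((fderiv ℝ ψ (x - t)).comp (-ContinuousLinearMap.id ℝ (Euc n))) t :=
      (hψ1.differentiable one_ne_zero _).hasFDerivAt.comp t ((hasFDerivAt_id t).const_sub x)
    rw [h1.fderiv]; simp
  have hder : fderiv ℝ (ψ ⋆[ContinuousLinearMap.lsmul ℝ ℝ, volume] Ω.indicator f) x v =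
      ∫ y in Ω, ⟪g y, v⟫ * η y := by
    rw [← convolution_flip, (hψc.hasFDerivAt_convolution_right
      (ContinuousLinearMap.lsmul ℝ ℝ).flip hF hψ1 x).fderiv, convolution_def,
      ContinuousLinearMap.integral_apply]
    · have h2 := hfg.2.2 η hη hηc hηΩ v
      rw [← neg_eq_iff_eq_neg, ← integral_neg] at h2
      rw [← h2, ← integral_indicator hΩ]
      refine integral_congr_ae (Eventually.of_forall fun t => ?_)
      by_cases ht : t ∈ Ω <;> simp [ht, hηd, ContinuousLinearMap.precompR_apply, mul_comm]
    · exact (hψc.fderiv ℝ).convolutionExists_right _ hF (hψ1.continuous_fderiv one_ne_zero) x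
  rw [hder, ← toReal_enorm, ← toReal_enorm v, ← ENNReal.toReal_mul]
  refine ENNReal.toReal_mono (mul_ne_top hM enorm_ne_top) ?_
  refine (enorm_integral_le_lintegral_enorm _).trans ?_
  rw [← lintegral_mul_const' _ _ enorm_ne_top]
  refine lintegral_mono fun y => ?_
  have h3 : ‖η y‖ₑ = ENNReal.ofReal (ψ (x - y)) := by
    rw [← ofReal_norm, Real.norm_of_nonneg (φ.nonneg_normed _)]
  rw [enorm_mul, h3, mul_right_comm]
  gcongr
  rw [← ofReal_norm, ← ofReal_norm, ← ofReal_norm, ← ENNReal.ofReal_mul (norm_nonneg _)]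
  exact ENNReal.ofReal_le_ofReal (norm_inner_le_norm _ _)

theorem lintegral_ball_enorm_fderiv_convolution_le {n : ℕ} {Ω : Set (Euc n)} {f : Euc n → ℝ}
    {g : Euc n → Euc n} (hfg : HasWeakGradientOn f g Ω) (hΩ : MeasurableSet Ω)
    (hfi : IntegrableOn f Ω) (hgi : IntegrableOn g Ω) (φ : ContDiffBump (0 : Euc n))
    {z₀ : Euc n} {r : ℝ} (hr : Metric.ball z₀ (r + φ.rOut) ⊆ Ω) :
    ∫⁻ x in Metric.ball z₀ r,
        ‖fderiv ℝ (φ.normed volume ⋆[ContinuousLinearMap.lsmul ℝ ℝ, volume] Ω.indicator f) x‖ₑ ≤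
      ∫⁻ y in Metric.ball z₀ (r + φ.rOut), ‖g y‖ₑ := by
  set ψ := φ.normed (volume : Measure (Euc n))
  have hψm : Measurable ψ := φ.continuous_normed.measurable
  calc _ ≤ ∫⁻ x in Metric.ball z₀ r, ∫⁻ y in Ω, ‖g y‖ₑ * ENNReal.ofReal (ψ (x - y)) := by
        refine setLIntegral_mono' measurableSet_ball fun x hx =>
          enorm_fderiv_convolution_le hfg hΩ hfi φ (Subset.trans ?_ hr)
        refine fun y hy => ?_
        rw [Metric.mem_ball] at *
        rw [Metric.mem_closedBall] at hy
        linarith [dist_triangle y x z₀]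
    _ = ∫⁻ y in Ω, ∫⁻ x in Metric.ball z₀ r, ‖g y‖ₑ * ENNReal.ofReal (ψ (x - y)) := by
        have h1 : AEMeasurable (fun x : Euc n × Euc n => ‖g x.2‖ₑ)
            ((volume.restrict (Metric.ball z₀ r)).prod (volume.restrict Ω)) :=
          hgi.aestronglyMeasurable.enorm.comp_snd
        have h2 : Measurable (fun x : Euc n × Euc n => ENNReal.ofReal (ψ (x.1 - x.2))) := by
          fun_prop
        exact lintegral_lintegral_swap (h1.mul h2.aemeasurable)
    _ ≤ ∫⁻ y in Ω, (Metric.ball z₀ (r + φ.rOut)).indicator (fun y => ‖g y‖ₑ) y := by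
        refine lintegral_mono fun y => ?_
        rw [lintegral_const_mul _ (by fun_prop)]
        by_cases hy : y ∈ Metric.ball z₀ (r + φ.rOut)
        · rw [indicator_of_mem hy]
          refine mul_le_of_le_one_right' ((setLIntegral_le_lintegral _ _).trans ?_)
          rw [lintegral_sub_right_eq_self (fun x => ENNReal.ofReal (ψ x)) y,
            ← ofReal_integral_eq_lintegral_ofReal φ.integrable_normed
              (Eventually.of_forall φ.nonneg_normed), φ.integral_normed, ENNReal.ofReal_one]
        · rw [indicator_of_notMem hy, setLIntegral_eq_zero measurableSet_ball, mul_zero]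
          intro x hx
          have : x - y ∉ Function.support ψ := by
            rw [φ.support_normed_eq, mem_ball_zero_iff, ← dist_eq_norm]
            rw [Metric.mem_ball] at hx hy
            intro h
            rw [dist_comm] at h
            linarith [dist_triangle y x z₀]
          simp [Function.notMem_support.1 this]
    _ = ∫⁻ y in Metric.ball z₀ (r + φ.rOut), ‖g y‖ₑ := by
        rw [lintegral_indicator measurableSet_ball, Measure.restrict_restrict measurableSet_ball,
          inter_eq_left.2 hr]

/-- `L²` oscillation bounds pass to almost everywhere limits. -/
theorem exists_lintegral_sq_le_of_tendsto {X : Type*} [MeasurableSpace X] {μ : Measure X} [NeZero μ]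
    {u : ℕ → X → ℝ} {f : X → ℝ} (hu : ∀ n, AEMeasurable (u n) μ)
    (huf : ∀ᵐ x ∂μ, Tendsto (fun n => u n x) atTop (𝓝 (f x)))
    {c : ℕ → ℝ} {M : ℕ → ℝ≥0∞} {K : ℝ≥0∞} (hc : ∀ n, ∫⁻ x, ‖u n x - c n‖ₑ ^ 2 ∂μ ≤ M n)
    (hM : Tendsto M atTop (𝓝 K)) (hK : K ≠ ∞) :
    ∃ a : ℝ, ∫⁻ x, ‖f x - a‖ₑ ^ 2 ∂μ ≤ K := by
  have fatou : ∀ (k : ℕ → ℕ) (h : X → ℝ≥0∞), StrictMono k →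
      (∀ᵐ x ∂μ, Tendsto (fun n => ‖u (k n) x - c (k n)‖ₑ ^ 2) atTop (𝓝 (h x))) →
      ∫⁻ x, h x ∂μ ≤ K := by
    intro k h hk hlim
    calc ∫⁻ x, h x ∂μ = ∫⁻ x, liminf (fun n => ‖u (k n) x - c (k n)‖ₑ ^ 2) atTop ∂μ :=
          lintegral_congr_ae (hlim.mono fun x hx => hx.liminf_eq.symm)
      _ ≤ liminf (fun n => ∫⁻ x, ‖u (k n) x - c (k n)‖ₑ ^ 2 ∂μ) atTop :=
          lintegral_liminf_le' fun n => (((hu (k n)).sub_const _).enorm.pow_const 2)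
      _ ≤ liminf (fun n => M (k n)) atTop := liminf_le_liminf (Eventually.of_forall fun n => hc (k n))
      _ = K := (hM.comp hk.tendsto_atTop).liminf_eq
  by_cases hbdd : ∃ R, ∃ᶠ n in atTop, c n ∈ Metric.closedBall 0 R
  · obtain ⟨R, hR⟩ := hbdd
    obtain ⟨a, -, k, hk, hka⟩ := tendsto_subseq_of_frequently_bounded Metric.isBounded_closedBall hR
    refine ⟨a, fatou k _ hk (huf.mono fun x hx => ?_)⟩
    exact ENNReal.Tendsto.pow ((hx.comp hk.tendsto_atTop).sub hka).enorm
  · exfalso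
    push Not at hbdd
    have hcinf : Tendsto (fun n => ‖c n‖) atTop atTop := by
      refine tendsto_atTop.2 fun R => (hbdd R).mono fun n hn => ?_
      rw [mem_closedBall_zero_iff, not_le] at hn
      exact hn.le
    have htop : ∫⁻ _, ∞ ∂μ ≤ K := by
      refine fatou id _ strictMono_id (huf.mono fun x hx => ?_)
      have h1 : Tendsto (fun n => ‖u n x - c n‖) atTop atTop := by
        refine tendsto_atTop_mono (fun n => ?_)
          (tendsto_atTop_add_left_of_le' _ (-(‖f x‖ + 1)) (f := fun n => -‖u n x‖) ?_ hcinf)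
        · have := norm_sub_norm_le (c n) (u n x)
          rw [norm_sub_rev] at this
          linarith
        · filter_upwards [hx.norm.eventually_lt_const (lt_add_one _)] with n hn
          linarith
      have h2 := ENNReal.Tendsto.pow (n := 2) (ENNReal.tendsto_ofReal_atTop.comp h1)
      simpa only [Function.comp_def, ofReal_norm, id, ENNReal.top_pow two_ne_zero] using h2
    rw [lintegral_const, ENNReal.top_mul (by simp [NeZero.ne μ])] at htop
    exact hK (top_le_iff.1 htop)

theorem lintegral_sub_average_sq_le {X : Type*} [MeasurableSpace X] {μ : Measure X}
    [IsFiniteMeasure μ] {f : X → ℝ} (hf : Integrable f μ) (c : ℝ) :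
    ∫⁻ x, ENNReal.ofReal ((f x - ⨍ y, f y ∂μ) ^ 2) ∂μ ≤ ∫⁻ x, ‖f x - c‖ₑ ^ 2 ∂μ := by
  rcases eq_or_ne (∫⁻ x, ‖f x - c‖ₑ ^ 2 ∂μ) ∞ with htop | htop
  · rw [htop]; exact le_top
  set m := ⨍ y, f y ∂μ
  have hsq : ∀ y : ℝ, ‖y‖ₑ ^ 2 = ENNReal.ofReal (y ^ 2) := fun y => by
    rw [← ofReal_norm, ← ENNReal.ofReal_pow (norm_nonneg _), Real.norm_eq_abs, sq_abs]
  simp_rw [hsq] at htop ⊢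
  have hc : Integrable (fun x => f x - c) μ := hf.sub (integrable_const c)
  have hc2 : Integrable (fun x => (f x - c) ^ 2) μ :=
    (lintegral_ofReal_ne_top_iff_integrable (hc.aestronglyMeasurable.pow 2)
      (Eventually.of_forall fun x => sq_nonneg _)).1 htop
  have hexp : ∀ x, (f x - m) ^ 2 = (f x - c) ^ 2 - 2 * (m - c) * (f x - c) + (m - c) ^ 2 :=
    fun x => by ring
  have hm2 : Integrable (fun x => (f x - m) ^ 2) μ := by
    simp_rw [hexp]
    exact (hc2.sub (hc.const_mul _)).add (integrable_const _)
  rw [← ofReal_integral_eq_lintegral_ofReal hm2 (Eventually.of_forall fun x => sq_nonneg _),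
    ← ofReal_integral_eq_lintegral_ofReal hc2 (Eventually.of_forall fun x => sq_nonneg _)]
  refine ENNReal.ofReal_le_ofReal ?_
  have hint : ∫ x, f x ∂μ = μ.real univ * m := (measure_smul_average μ f).symm
  have h1 : ∫ x, (f x - m) ^ 2 ∂μ = ∫ x, (f x - c) ^ 2 ∂μ - μ.real univ * (m - c) ^ 2 := by
    simp_rw [hexp]
    rw [integral_add (f := fun x => (f x - c) ^ 2 - 2 * (m - c) * (f x - c))
        (hc2.sub (hc.const_mul _)) (integrable_const _),
      integral_sub hc2 (hc.const_mul _), integral_const_mul, integral_sub hf (integrable_const c),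
      hint]
    simp only [integral_const, smul_eq_mul]
    ring
  rw [h1]
  exact sub_le_self _ (by positivity)

theorem statement_15 (Ω : Set (Euc 2)) (hΩ : IsDomainIn Ω)
    (f : Euc 2 → ℝ) (g : Euc 2 → Euc 2)
    (hfg : HasWeakGradientOn f g Ω) (hfi : IntegrableOn f Ω) (hgi : IntegrableOn g Ω)
    (r : ℝ) (hr : 0 < r) (z₀ : Euc 2) (hz₀ : z₀ ∈ Ω)
    (hdist : 2 * r < Metric.infDist z₀ Ωᶜ) :
    (∫⁻ z in Metric.ball z₀ r,
        ENNReal.ofReal ((f z - ⨍ w in Metric.ball z₀ r, f w) ^ 2)) ^ ((1:ℝ)/2) ≤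
      ENNReal.ofReal (3 * Real.sqrt (Real.pi ^ 3) / 4) *
        ∫⁻ z in Metric.ball z₀ r, (‖g z‖₊ : ℝ≥0∞) := by
  have hball : Metric.ball z₀ (2 * r) ⊆ Ω := fun x hx => by
    by_contra hxΩ
    have := Metric.infDist_le_dist_of_mem (x := z₀) (s := Ωᶜ) hxΩ
    rw [Metric.mem_ball, dist_comm] at hx
    linarith
  have hsub : Metric.ball z₀ r ⊆ Ω := (Metric.ball_subset_ball (by linarith)).trans hball
  have hΩm : MeasurableSet Ω := hΩ.1.measurableSet
  have hε : ∀ n : ℕ, 0 < r / (n + 1) := fun n => by positivity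
  have hεr : ∀ n : ℕ, r / (n + 1) ≤ r := fun n =>
    div_le_self hr.le (by linarith [n.cast_nonneg (α := ℝ)])
  have hε0 : Tendsto (fun n : ℕ => r / ((n : ℝ) + 1)) atTop (𝓝 0) :=
    tendsto_const_div_atTop_nhds_zero_nat r |>.comp (tendsto_add_atTop_nat 1) |>.congr
      fun n => by simp
  let φ : ℕ → ContDiffBump (0 : Euc 2) := fun n =>
    ⟨r / (n + 1) / 2, r / (n + 1), half_pos (hε n), half_lt_self (hε n)⟩
  have hFi : LocallyIntegrable (Ω.indicator f) :=
    ((integrable_indicator_iff hΩm).2 hfi).locallyIntegrable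
  let u : ℕ → Euc 2 → ℝ := fun n =>
    (φ n).normed volume ⋆[ContinuousLinearMap.lsmul ℝ ℝ, volume] Ω.indicator f
  have hu : ∀ n, ContDiff ℝ 1 (u n) := fun n =>
    (φ n).hasCompactSupport_normed.contDiff_convolution_left _ (φ n).contDiff_normed hFi
  have hlim : ∀ᵐ x ∂volume.restrict (Metric.ball z₀ r),
      Tendsto (fun n => u n x) atTop (𝓝 (f x)) := by
    have h1 : ∀ᵐ x, Tendsto (fun n => u n x) atTop (𝓝 (Ω.indicator f x)) :=
      ContDiffBump.ae_convolution_tendsto_right_of_locallyIntegrable (K := 2) hε0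
        (Eventually.of_forall fun n => le_of_eq (by simp only [φ]; ring)) hFi
    filter_upwards [ae_restrict_of_ae h1, ae_restrict_mem measurableSet_ball] with x hx hxm
    rwa [indicator_of_mem (hsub hxm)] at hx
  choose c hc using fun n => exists_lintegral_ball_sq_le (hu n) r z₀
  set C := ENNReal.ofReal (9 * Real.pi ^ 3 / 16)
  set T := ∫⁻ z in Metric.ball z₀ r, ‖g z‖ₑ
  have hT : T ≠ ∞ := (hgi.mono_set hsub).2.ne
  have hTlim : Tendsto (fun n : ℕ => ∫⁻ z in Metric.ball z₀ (r + r / (n + 1)), ‖g z‖ₑ)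
      atTop (𝓝 T) := by
    let ν : Measure (Euc 2) := (volume.restrict Ω).withDensity (fun z => ‖g z‖ₑ)
    have : IsFiniteMeasure ν := isFiniteMeasure_withDensity hgi.2.ne
    have hν : ∀ s, MeasurableSet s → s ⊆ Ω → ν s = ∫⁻ z in s, ‖g z‖ₑ := fun s hs hsΩ => by
      rw [withDensity_apply _ hs, Measure.restrict_restrict hs, inter_eq_left.2 hsΩ]
    have h1 := (tendsto_measure_thickening_of_isClosed (μ := ν) (s := Metric.closedBall z₀ r)
      ⟨1, one_pos, measure_ne_top _ _⟩ Metric.isClosed_closedBall).comp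
      (tendsto_nhdsWithin_iff.2 ⟨hε0, Eventually.of_forall hε⟩)
    have hae : Metric.ball z₀ r =ᵐ[volume] Metric.closedBall z₀ r :=
      ae_eq_of_subset_of_measure_ge Metric.ball_subset_closedBall
        (Measure.addHaar_closedBall_eq_addHaar_ball volume z₀ r).le
        measurableSet_ball.nullMeasurableSet measure_closedBall_lt_top.ne
    rw [hν _ Metric.isClosed_closedBall.measurableSet
      ((Metric.closedBall_subset_ball (by linarith)).trans hball),
      ← setLIntegral_congr hae] at h1
    refine h1.congr fun n => ?_
    rw [Function.comp_apply, thickening_closedBall (hε n) hr.le, add_comm,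
      hν _ measurableSet_ball ((Metric.ball_subset_ball (by linarith [hεr n])).trans hball)]
  have : NeZero (volume.restrict (Metric.ball z₀ r)) :=
    ⟨by rw [Ne, Measure.restrict_eq_zero]; exact (Metric.measure_ball_pos _ _ hr).ne'⟩
  have hgrad : ∀ n : ℕ, ∫⁻ z in Metric.ball z₀ r, ‖fderiv ℝ (u n) z‖ₑ ≤
      ∫⁻ z in Metric.ball z₀ (r + r / (n + 1)), ‖g z‖ₑ := fun n =>
    lintegral_ball_enorm_fderiv_convolution_le hfg hΩm hfi hgi (φ n)
      ((Metric.ball_subset_ball (by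
        change r + r / (n + 1) ≤ 2 * r
        linarith [hεr n])).trans hball)
  obtain ⟨a, ha⟩ := exists_lintegral_sq_le_of_tendsto
    (M := fun n : ℕ => C * (∫⁻ z in Metric.ball z₀ (r + r / (n + 1)), ‖g z‖ₑ) ^ 2)
    (fun n => (hu n).continuous.aemeasurable) hlim
    (fun n => (hc n).trans (mul_le_mul' le_rfl (pow_le_pow_left' (hgrad n) 2)))
    (ENNReal.Tendsto.const_mul (ENNReal.Tendsto.pow hTlim) (Or.inr ofReal_ne_top))
    (mul_ne_top ofReal_ne_top (ENNReal.pow_ne_top hT))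
  have hC : C = ENNReal.ofReal (3 * Real.sqrt (Real.pi ^ 3) / 4) ^ 2 := by
    rw [← ENNReal.ofReal_pow (by positivity), div_pow, mul_pow, Real.sq_sqrt (by positivity)]
    norm_num [C]
  have : IsFiniteMeasure (volume.restrict (Metric.ball z₀ r)) :=
    isFiniteMeasure_restrict.2 measure_ball_lt_top.ne
  have hfin := (lintegral_sub_average_sq_le (hfi.mono_set hsub) a).trans ha
  rw [hC, ← mul_pow] at hfin
  refine (ENNReal.rpow_le_rpow hfin (by norm_num : (0 : ℝ) ≤ 1 / 2)).trans_eq ?_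
  rw [← ENNReal.rpow_natCast, ← ENNReal.rpow_mul]
  norm_num
  rfl
end
end
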